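/- arXiv:2312.01112 — 6 statements merged into one kernel-verified Lean document; each statement's English description precedes it below -/
import Mathlib

section
/- Fix z ∈ ℂ and ω₁ ∈ ℂ∖{0}. On the open set of ω₂ ∈ ℂ∖{0} such that Im(ω₂/ω₁) > 0 and z does not lie in the lattice Ω = {m₁ω₁ + m₂ω₂ : m₁, m₂ ∈ ℤ}, the function ω₂ ↦ σ(z; ω₁, ω₂) is complex differentiable with respect to ω₂ and its derivative equals −σ(z; ω₁, ω₂) · (1/(2πi)) · [ (1/2)·ω₁·(℘(z) − ζ(z)²) + η₁·(z·ζ(z) − 1) − (g₂/24)·ω₁·z² ], where ℘, ζ, σ, η₁, g₂ are the Weierstrass data associated with the periods (ω₁, ω₂). -/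
open Complex Filter Topology

/-- The period lattice `Ω = {m₁ω₁ + m₂ω₂ : m₁, m₂ ∈ ℤ}`. -/
def lattice (ω₁ ω₂ : ℂ) : Set ℂ :=
  {w | ∃ m₁ m₂ : ℤ, w = (m₁ : ℂ) * ω₁ + (m₂ : ℂ) * ω₂}

/-- The nonzero lattice points, as a subtype (index of summation). -/
abbrev latticeNZ (ω₁ ω₂ : ℂ) : Type :=
  {w : ℂ // w ∈ lattice ω₁ ω₂ ∧ w ≠ 0}

/-- Weierstrass ℘-function associated with periods `(ω₁, ω₂)`. -/
noncomputable def wP (ω₁ ω₂ z : ℂ) : ℂ :=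
  1 / z ^ 2 + ∑' w : latticeNZ ω₁ ω₂, (1 / (z - (w : ℂ)) ^ 2 - 1 / (w : ℂ) ^ 2)

/-- Weierstrass ζ-function associated with periods `(ω₁, ω₂)`. -/
noncomputable def wZeta (ω₁ ω₂ z : ℂ) : ℂ :=
  1 / z + ∑' w : latticeNZ ω₁ ω₂, (1 / (z - (w : ℂ)) + 1 / (w : ℂ) + z / (w : ℂ) ^ 2)

/-- Weierstrass σ-function associated with periods `(ω₁, ω₂)`. -/
noncomputable def wSigma (ω₁ ω₂ z : ℂ) : ℂ :=
  z * ∏' w : latticeNZ ω₁ ω₂,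
    ((1 - z / (w : ℂ)) * Complex.exp (z / (w : ℂ) + z ^ 2 / (2 * (w : ℂ) ^ 2)))

/-- Quasi-period constant `η₁ = 2ζ(ω₁/2)`. -/
noncomputable def eta1 (ω₁ ω₂ : ℂ) : ℂ := 2 * wZeta ω₁ ω₂ (ω₁ / 2)

/-- Quasi-period constant `η₂ = 2ζ(ω₂/2)`. -/
noncomputable def eta2 (ω₁ ω₂ : ℂ) : ℂ := 2 * wZeta ω₁ ω₂ (ω₂ / 2)

/-- Weierstrass invariant `g₂ = 60 Σ ω⁻⁴`. -/
noncomputable def g2 (ω₁ ω₂ : ℂ) : ℂ :=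
  60 * ∑' w : latticeNZ ω₁ ω₂, 1 / (w : ℂ) ^ 4

namespace WeierstrassSigma

/-- The lattice point with coordinates `m.2` along `a` and `m.1` along `b`. -/
def latPt (a b : ℂ) (m : ℤ × ℤ) : ℂ := (m.2 : ℂ) * a + (m.1 : ℂ) * b

lemma latPt_zero (a b : ℂ) : latPt a b 0 = 0 := by simp [latPt]

lemma latPt_neg (a b : ℂ) (m : ℤ × ℤ) : latPt a b (-m) = -latPt a b m := by
  simp [latPt]; ring

lemma latPt_add (a b : ℂ) (m n : ℤ × ℤ) : latPt a b (m + n) = latPt a b m + latPt a b n := by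
  simp [latPt]; ring

lemma mem_lattice_iff {a b w : ℂ} : w ∈ lattice a b ↔ ∃ m, latPt a b m = w :=
  ⟨fun ⟨m₁, m₂, h⟩ ↦ ⟨(m₂, m₁), h.symm⟩, fun ⟨m, h⟩ ↦ ⟨m.2, m.1, h.symm⟩⟩

lemma latPt_mem_lattice (a b : ℂ) (m : ℤ × ℤ) : latPt a b m ∈ lattice a b :=
  mem_lattice_iff.mpr ⟨m, rfl⟩

lemma norm_le_norm_latPt {a b : ℂ} (h : 0 < (b / a).im) :
    ∃ r > 0, ∀ m : ℤ × ℤ, r * ‖m‖ ≤ ‖latPt a b m‖ := by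
  have ha : a ≠ 0 := by rintro rfl; simp at h
  have hapos : 0 < ‖a‖ := norm_pos_iff.mpr ha
  set y := (b / a).im with hy
  set A := (‖a‖ * y)⁻¹ with hA
  have hApos : 0 < A := by positivity
  set B := (1 + A * ‖b‖) / ‖a‖ with hB
  have hBpos : 0 < B := by positivity
  refine ⟨(A + B)⁻¹, by positivity, fun m ↦ ?_⟩
  have h1 : ‖(m.1 : ℂ)‖ ≤ A * ‖latPt a b m‖ := by
    have e : (latPt a b m / a).im = m.1 * y := by
      have : latPt a b m / a = (m.2 : ℂ) + (m.1 : ℂ) * (b / a) := by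
        simp only [latPt]; field_simp
      rw [this]; simp [hy]
    have := Complex.abs_im_le_norm (latPt a b m / a)
    rw [e, norm_div, abs_mul, abs_of_pos h] at this
    rw [hA, inv_mul_eq_div, le_div_iff₀ (by positivity)]
    rw [le_div_iff₀ hapos] at this
    simp only [Complex.norm_intCast]
    linarith
  have h2 : ‖(m.2 : ℂ)‖ ≤ B * ‖latPt a b m‖ := by
    have : ‖(m.2 : ℂ) * a‖ ≤ ‖latPt a b m‖ + ‖(m.1 : ℂ) * b‖ := by
      have e : (m.2 : ℂ) * a = latPt a b m - (m.1 : ℂ) * b := by simp [latPt]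
      rw [e]; exact norm_sub_le _ _
    rw [norm_mul, norm_mul] at this
    rw [hB, div_mul_eq_mul_div, le_div_iff₀ hapos]
    nlinarith [mul_le_mul_of_nonneg_right h1 (norm_nonneg b)]
  rw [inv_mul_le_iff₀ (by positivity), Prod.norm_def, add_mul]
  refine max_le ?_ ?_
  · have : ‖m.1‖ = ‖(m.1 : ℂ)‖ := by simp [Int.norm_eq_abs]
    rw [this]
    have : 0 ≤ B * ‖latPt a b m‖ := by positivity
    linarith
  · have : ‖m.2‖ = ‖(m.2 : ℂ)‖ := by simp [Int.norm_eq_abs]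
    rw [this]
    have : 0 ≤ A * ‖latPt a b m‖ := by positivity
    linarith

lemma latPt_eq_zero {a b : ℂ} (h : 0 < (b / a).im) {m : ℤ × ℤ} : latPt a b m = 0 ↔ m = 0 := by
  refine ⟨fun e ↦ ?_, fun e ↦ e ▸ latPt_zero a b⟩
  obtain ⟨r, hr, H⟩ := norm_le_norm_latPt h
  have := H m
  rw [e, norm_zero] at this
  exact norm_le_zero_iff.mp (by nlinarith [norm_nonneg m])

lemma latPt_injective {a b : ℂ} (h : 0 < (b / a).im) : Function.Injective (latPt a b) := by
  intro m n e
  rw [← sub_eq_zero, ← latPt_eq_zero h, sub_eq_add_neg, latPt_add, latPt_neg, e, add_neg_cancel]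

lemma summable_norm_rpow_int_prod : Summable fun m : ℤ × ℤ ↦ ‖m‖ ^ (-3 : ℝ) := by
  have := EisensteinSeries.summable_one_div_norm_rpow (k := 3) (by norm_num)
  rw [← (finTwoArrowEquiv ℤ).symm.summable_iff] at this
  refine this.congr fun m ↦ ?_
  have e : ‖![m.1, m.2]‖ = ‖m‖ := by
    simp [EisensteinSeries.norm_eq_max_natAbs, Prod.norm_def, Int.norm_eq_abs]
  simp [← e, finTwoArrowEquiv]

/-- Nonzero lattice points are the lattice points with nonzero coordinates. -/
noncomputable def latticeNZEquiv {a b : ℂ} (h : 0 < (b / a).im) :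
    {m : ℤ × ℤ // m ≠ 0} ≃ latticeNZ a b :=
  Equiv.ofBijective
    (fun m ↦ ⟨latPt a b m, latPt_mem_lattice a b m, (latPt_eq_zero h).not.mpr m.2⟩)
    ⟨fun _ _ e ↦ Subtype.ext (latPt_injective h (congrArg Subtype.val e)), by
      rintro ⟨w, hw, hw0⟩
      obtain ⟨m, rfl⟩ := mem_lattice_iff.mp hw
      exact ⟨⟨m, (latPt_eq_zero h).not.mp hw0⟩, rfl⟩⟩

lemma tprod_latticeNZ {a b : ℂ} (h : 0 < (b / a).im) (f : ℂ → ℂ) (hf : f 0 = 1) :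
    ∏' w : latticeNZ a b, f w = ∏' m : ℤ × ℤ, f (latPt a b m) := by
  rw [← (latticeNZEquiv h).tprod_eq]
  refine Function.Injective.tprod_eq (f := fun m ↦ f (latPt a b m)) Subtype.val_injective ?_
  intro m hm
  refine ⟨⟨m, ?_⟩, rfl⟩
  rintro rfl
  simp [latPt_zero, hf] at hm

lemma tsum_latticeNZ {a b : ℂ} (h : 0 < (b / a).im) (f : ℂ → ℂ) (hf : f 0 = 0) :
    ∑' w : latticeNZ a b, f w = ∑' m : ℤ × ℤ, f (latPt a b m) := by
  rw [← (latticeNZEquiv h).tsum_eq]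
  refine Function.Injective.tsum_eq (f := fun m ↦ f (latPt a b m)) Subtype.val_injective ?_
  intro m hm
  refine ⟨⟨m, ?_⟩, rfl⟩
  rintro rfl
  simp [latPt_zero, hf] at hm

lemma countable_lattice (a b : ℂ) : (lattice a b).Countable := by
  have : lattice a b = Set.range (latPt a b) := by
    ext; rw [mem_lattice_iff, Set.mem_range]
  rw [this]
  exact Set.countable_range _

/-- Admissible weights grow at most linearly. -/
def IsWeight (c : ℤ × ℤ → ℂ) : Prop := ∀ m ≠ 0, ‖c m‖ ≤ ‖m‖

lemma one_le_norm_of_ne_zero {m : ℤ × ℤ} (hm : m ≠ 0) : 1 ≤ ‖m‖ := by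
  rw [Prod.norm_def, le_max_iff]
  have : m.1 ≠ 0 ∨ m.2 ≠ 0 := by
    by_contra! h
    exact hm (Prod.ext h.1 h.2)
  refine this.imp (fun h ↦ ?_) (fun h ↦ ?_) <;>
  · rw [Int.norm_eq_abs]
    exact_mod_cast Int.one_le_abs h

lemma isWeight_one : IsWeight 1 := fun m hm ↦ by simpa using one_le_norm_of_ne_zero hm

lemma isWeight_fst : IsWeight fun m ↦ m.1 := fun m _ ↦ by
  simp [Int.norm_eq_abs, Prod.norm_def]

/-- The complement of the set of nonzero lattice points. -/
def regularSet (a b : ℂ) : Set ℂ := (lattice a b \ {0})ᶜ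

/-- The periods as a `PeriodPair`. -/
def periodPair {a b : ℂ} (h : 0 < (b / a).im) : PeriodPair where
  ω₁ := a
  ω₂ := b
  indep := by
    have ha : a ≠ 0 := by rintro rfl; simp at h
    rw [LinearIndependent.pair_iff]
    intro s t e
    have e' : (s : ℂ) + t * (b / a) = 0 := by
      simp only [Complex.real_smul] at e
      field_simp
      linear_combination e
    have ht : t = 0 := by
      have := congrArg Complex.im e'
      simpa [h.ne'] using this
    subst ht
    simpa using e'

lemma coe_lattice_periodPair {a b : ℂ} (h : 0 < (b / a).im) :
    ((periodPair h).lattice : Set ℂ) = lattice a b := by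
  ext w
  simp only [SetLike.mem_coe, PeriodPair.mem_lattice, lattice, Set.mem_ofPred_eq, periodPair,
    eq_comm]

lemma isOpen_regularSet {a b : ℂ} (h : 0 < (b / a).im) : IsOpen (regularSet a b) := by
  rw [regularSet, ← coe_lattice_periodPair h]
  exact (periodPair h).isOpen_compl_lattice_sdiff

lemma isOpen_compl_lattice {a b : ℂ} (h : 0 < (b / a).im) : IsOpen (lattice a b)ᶜ := by
  rw [← coe_lattice_periodPair h]
  exact (periodPair h).isClosed_lattice.isOpen_compl

lemma compl_lattice_subset (a b : ℂ) : (lattice a b)ᶜ ⊆ regularSet a b :=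
  Set.compl_subset_compl.mpr Set.sdiff_subset

lemma zero_mem_regularSet (a b : ℂ) : (0 : ℂ) ∈ regularSet a b := by simp [regularSet]

lemma isPreconnected_regularSet (a b : ℂ) : IsPreconnected (regularSet a b) := by
  refine (Set.Countable.isPathConnected_compl_of_one_lt_rank (by simp) ?_).isConnected.isPreconnected
  exact (countable_lattice a b).mono Set.sdiff_subset

lemma latPt_sub_ne_zero {a b z : ℂ} (hz : z ∈ regularSet a b) {m : ℤ × ℤ}
    (hm : latPt a b m ≠ 0) : latPt a b m - z ≠ 0 := by
  intro e
  rw [sub_eq_zero] at e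
  exact hz ⟨e ▸ latPt_mem_lattice a b m, by simpa [← e] using hm⟩

/-- The term at `m` of `weightedSum`. -/
noncomputable def weightedTerm (a b : ℂ) (c : ℤ × ℤ → ℂ) (m : ℤ × ℤ) (z : ℂ) : ℂ :=
  c m / (latPt a b m ^ 3 * (latPt a b m - z))

/-- The weighted lattice sum `∑ c(w) / (w³ (w - z))`. -/
noncomputable def weightedSum (a b : ℂ) (c : ℤ × ℤ → ℂ) (z : ℂ) : ℂ :=
  ∑' m, weightedTerm a b c m z

lemma eventually_cofinite_le_norm (R : ℝ) : ∀ᶠ m : ℤ × ℤ in cofinite, R ≤ ‖m‖ := by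
  refine (isCompact_iff_finite.mp (isCompact_closedBall (0 : ℤ × ℤ) R)).subset ?_
  intro m hm
  have hm : ¬ R ≤ ‖m‖ := hm
  simpa using (not_le.mp hm).le

lemma norm_weightedTerm_le {a b : ℂ} {c : ℤ × ℤ → ℂ} (hc : IsWeight c) {r R : ℝ} (hr : 0 < r)
    (hR : 0 < R) (H : ∀ m : ℤ × ℤ, r * ‖m‖ ≤ ‖latPt a b m‖) {m : ℤ × ℤ} (hm : 2 * R / r ≤ ‖m‖)
    {z : ℂ} (hz : ‖z‖ < R) : ‖weightedTerm a b c m z‖ ≤ 2 * r⁻¹ ^ 4 * ‖m‖ ^ (-3 : ℝ) := by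
  have hm0 : 0 < ‖m‖ := lt_of_lt_of_le (by positivity) hm
  rw [div_le_iff₀ hr] at hm
  have h1 := H m
  have h2 : r * ‖m‖ / 2 ≤ ‖latPt a b m - z‖ := by
    have := norm_sub_norm_le (latPt a b m) z
    linarith
  have e : 2 * r⁻¹ ^ 4 * ‖m‖ ^ (-3 : ℝ) = ‖m‖ / ((r * ‖m‖) ^ 3 * (r * ‖m‖ / 2)) := by
    rw [Real.rpow_neg hm0.le, show (3 : ℝ) = (3 : ℕ) by norm_num, Real.rpow_natCast]
    field_simp
  rw [e, weightedTerm, norm_div, norm_mul, norm_pow]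
  gcongr
  exact hc m (norm_pos_iff.mp hm0)

lemma tendstoLocallyUniformly_weightedSum {a b : ℂ} (h : 0 < (b / a).im) {c : ℤ × ℤ → ℂ}
    (hc : IsWeight c) :
    TendstoLocallyUniformlyOn (fun s z ↦ ∑ m ∈ s, weightedTerm a b c m z) (weightedSum a b c)
      atTop (regularSet a b) := by
  obtain ⟨r, hr, H⟩ := norm_le_norm_latPt h
  refine TendstoLocallyUniformly.tendstoLocallyUniformlyOn ?_
  rw [tendstoLocallyUniformly_iff_filter]
  intro x
  have hx : 𝓝 x ≤ 𝓟 (Metric.ball 0 (‖x‖ + 1)) :=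
    Filter.le_principal_iff.mpr (Metric.isOpen_ball.mem_nhds (by simp))
  refine .mono_right ?_ hx
  rw [← tendstoUniformlyOn_iff_tendstoUniformlyOnFilter]
  refine tendstoUniformlyOn_tsum_of_cofinite_eventually
    (summable_norm_rpow_int_prod.mul_left (2 * r⁻¹ ^ 4)) ?_
  filter_upwards [eventually_cofinite_le_norm (2 * (‖x‖ + 1) / r)] with m hm z hz
  exact norm_weightedTerm_le hc hr (by positivity) H hm (by simpa using hz)

lemma hasDerivAt_weightedTerm {a b z : ℂ} (hz : z ∈ regularSet a b) (c : ℤ × ℤ → ℂ) (m : ℤ × ℤ) :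
    HasDerivAt (weightedTerm a b c m) (c m / (latPt a b m ^ 3 * (latPt a b m - z) ^ 2)) z := by
  by_cases hm : latPt a b m = 0
  · simpa [funext fun z ↦ (show weightedTerm a b c m z = 0 by simp [weightedTerm, hm]), hm] using
      hasDerivAt_const z (0 : ℂ)
  · have h1 := latPt_sub_ne_zero hz hm
    have h2 := (((hasDerivAt_id z).const_sub (latPt a b m)).const_mul (latPt a b m ^ 3)).fun_inv
      (mul_ne_zero (pow_ne_zero _ hm) h1)
    refine (h2.const_mul (c m)).congr_deriv ?_
    simp only [id]
    field_simp

section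

variable {a b : ℂ} (h : 0 < (b / a).im) {c : ℤ × ℤ → ℂ} (hc : IsWeight c)
include h hc

lemma differentiableOn_weightedSum : DifferentiableOn ℂ (weightedSum a b c) (regularSet a b) :=
  (tendstoLocallyUniformly_weightedSum h hc).differentiableOn
    (.of_forall fun _ ↦ .fun_sum fun m _ _ hz ↦
      (hasDerivAt_weightedTerm hz c m).differentiableAt.differentiableWithinAt)
    (isOpen_regularSet h)

lemma hasSum_weightedSum {z : ℂ} (hz : z ∈ regularSet a b) :
    HasSum (fun m ↦ weightedTerm a b c m z) (weightedSum a b c z) :=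
  (tendstoLocallyUniformly_weightedSum h hc).tendsto_at hz

lemma hasSum_deriv_weightedSum {z : ℂ} (hz : z ∈ regularSet a b) :
    HasSum (fun m ↦ c m / (latPt a b m ^ 3 * (latPt a b m - z) ^ 2))
      (deriv (weightedSum a b c) z) := by
  have := ((tendstoLocallyUniformly_weightedSum h hc).deriv
    (.of_forall fun _ ↦ .fun_sum fun m _ _ hz ↦
      (hasDerivAt_weightedTerm hz c m).differentiableAt.differentiableWithinAt)
    (isOpen_regularSet h)).tendsto_at hz
  refine this.congr fun s ↦ ?_
  exact (HasDerivAt.fun_sum fun m _ ↦ hasDerivAt_weightedTerm hz c m).deriv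

end

section

variable {a b : ℂ} (h : 0 < (b / a).im)
include h

lemma summable_one_div_latPt_pow_three : Summable fun m ↦ 1 / latPt a b m ^ 3 := by
  obtain ⟨r, hr, H⟩ := norm_le_norm_latPt h
  refine Summable.of_norm_bounded (summable_norm_rpow_int_prod.mul_left (r⁻¹ ^ 3)) fun m ↦ ?_
  rcases eq_or_ne m 0 with rfl | hm
  · simp only [latPt_zero]
    norm_num
  have hm0 : 0 < ‖m‖ := norm_pos_iff.mpr hm
  have h1 := H m
  have e : r⁻¹ ^ 3 * ‖m‖ ^ (-3 : ℝ) = 1 / (r * ‖m‖) ^ 3 := by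
    rw [Real.rpow_neg hm0.le, show (3 : ℝ) = (3 : ℕ) by norm_num, Real.rpow_natCast]
    field_simp
  rw [e, norm_div, norm_pow, norm_one]
  gcongr

lemma hasSum_one_div_latPt_pow_three : HasSum (fun m ↦ 1 / latPt a b m ^ 3) 0 := by
  obtain ⟨s, hs⟩ := summable_one_div_latPt_pow_three h
  have h1 := ((Equiv.neg (ℤ × ℤ)).hasSum_iff).mpr hs
  have h2 : HasSum (fun m ↦ 1 / latPt a b m ^ 3) (-s) := by
    refine (h1.neg).congr_fun fun m ↦ ?_
    simp only [Function.comp_apply, Equiv.neg_apply, latPt_neg]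
    rw [Odd.neg_pow (by decide), div_neg, neg_neg]
  have h3 : s = -s := hs.unique h2
  have : s = 0 := by linear_combination h3 / 2
  rwa [this] at hs

end

/-- The Weierstrass zeta function, in terms of `weightedSum`. -/
noncomputable def zetaFn (a b z : ℂ) : ℂ := 1 / z - z ^ 3 * weightedSum a b 1 z

/-- The Weierstrass `℘`-function, in terms of `weightedSum`. -/
noncomputable def pFn (a b z : ℂ) : ℂ :=
  1 / z ^ 2 + 3 * z ^ 2 * weightedSum a b 1 z + z ^ 3 * deriv (weightedSum a b 1) z

/-- The general term of the series for the zeta function. -/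
noncomputable def zetaTerm (z w : ℂ) : ℂ := 1 / (z - w) + 1 / w + z / w ^ 2

lemma zetaTerm_eq {z w : ℂ} (hw : w ≠ 0) (hz : w - z ≠ 0) :
    zetaTerm z w = -z ^ 3 * (1 / (w ^ 3 * (w - z))) - z ^ 2 * (1 / w ^ 3) := by
  have : z - w = -(w - z) := by ring
  rw [zetaTerm, this]
  field_simp
  ring

section

variable {a b : ℂ} (h : 0 < (b / a).im) {z : ℂ}
include h

lemma hasSum_neg_weighted_sub (hz : z ∈ regularSet a b) :
    HasSum (fun m ↦ -z ^ 3 * (1 / (latPt a b m ^ 3 * (latPt a b m - z))) -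
      z ^ 2 * (1 / latPt a b m ^ 3)) (-z ^ 3 * weightedSum a b 1 z) := by
  have := ((hasSum_weightedSum h isWeight_one hz).mul_left (-z ^ 3)).sub
    ((hasSum_one_div_latPt_pow_three h).mul_left (z ^ 2))
  simpa [weightedTerm] using this

lemma hasSum_zetaTerm (hz : z ∉ lattice a b) :
    HasSum (fun m ↦ zetaTerm z (latPt a b m)) (zetaFn a b z) := by
  have := (hasSum_neg_weighted_sub h (compl_lattice_subset a b hz)).add
    (hasSum_ite_eq (0 : ℤ × ℤ) (1 / z))
  rw [show zetaFn a b z = -z ^ 3 * weightedSum a b 1 z + 1 / z by rw [zetaFn]; ring]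
  refine this.congr_fun fun m ↦ ?_
  rcases eq_or_ne m 0 with rfl | hm
  · simp [zetaTerm, latPt_zero]
  · have hm' := (latPt_eq_zero h).not.mpr hm
    rw [zetaTerm_eq hm' (latPt_sub_ne_zero (compl_lattice_subset a b hz) hm'), if_neg hm, add_zero]

lemma wZeta_eq (hz : z ∉ lattice a b) : wZeta a b z = zetaFn a b z := by
  have hr := compl_lattice_subset a b hz
  have e (w : latticeNZ a b) : 1 / (z - (w : ℂ)) + 1 / (w : ℂ) + z / (w : ℂ) ^ 2 =
      -z ^ 3 * (1 / ((w : ℂ) ^ 3 * (w - z))) - z ^ 2 * (1 / (w : ℂ) ^ 3) :=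
    zetaTerm_eq w.2.2 (sub_ne_zero.mpr fun e ↦ hz (e ▸ w.2.1))
  rw [wZeta, tsum_congr e, tsum_latticeNZ h
    (fun w ↦ -z ^ 3 * (1 / (w ^ 3 * (w - z))) - z ^ 2 * (1 / w ^ 3)) (by simp),
    (hasSum_neg_weighted_sub h hr).tsum_eq, zetaFn]
  ring

lemma wP_eq (hz : z ∉ lattice a b) : wP a b z = pFn a b z := by
  have hr := compl_lattice_subset a b hz
  have e (w : latticeNZ a b) : 1 / (z - (w : ℂ)) ^ 2 - 1 / (w : ℂ) ^ 2 =
      3 * z ^ 2 * (1 / ((w : ℂ) ^ 3 * (w - z))) + z ^ 3 * (1 / ((w : ℂ) ^ 3 * (w - z) ^ 2)) +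
        2 * z * (1 / (w : ℂ) ^ 3) := by
    have h1 := w.2.2
    have h2 : (w : ℂ) - z ≠ 0 := sub_ne_zero.mpr fun e ↦ hz (e ▸ w.2.1)
    rw [← neg_sub (w : ℂ) z, neg_sq]
    field_simp
    ring
  have hs := (((hasSum_weightedSum h isWeight_one hr).mul_left (3 * z ^ 2)).add
    ((hasSum_deriv_weightedSum h isWeight_one hr).mul_left (z ^ 3))).add
    ((hasSum_one_div_latPt_pow_three h).mul_left (2 * z))
  simp only [weightedTerm, Pi.one_apply] at hs
  rw [wP, tsum_congr e, tsum_latticeNZ h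
    (fun w ↦ 3 * z ^ 2 * (1 / (w ^ 3 * (w - z))) + z ^ 3 * (1 / (w ^ 3 * (w - z) ^ 2)) +
        2 * z * (1 / w ^ 3)) (by simp), hs.tsum_eq, pFn]
  ring

lemma g2_eq : g2 a b = 60 * weightedSum a b 1 0 := by
  rw [g2, tsum_latticeNZ h (fun w ↦ 1 / w ^ 4) (by simp), weightedSum]
  congr 1
  refine tsum_congr fun m ↦ ?_
  simp [weightedTerm, ← pow_succ]

end

/-- The Weierstrass primary factor of genus two. -/
noncomputable def primaryFactor (x : ℂ) : ℂ := (1 - x) * cexp (x + x ^ 2 / 2)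

lemma hasDerivAt_primaryFactor (x : ℂ) :
    HasDerivAt primaryFactor (-x ^ 2 * cexp (x + x ^ 2 / 2)) x := by
  have h1 : HasDerivAt (fun x : ℂ ↦ x + x ^ 2 / 2) (1 + x) x := by
    refine ((hasDerivAt_id x).add ((hasDerivAt_pow 2 x).div_const 2)).congr_deriv ?_
    norm_num
  refine (((hasDerivAt_id x).const_sub 1).mul h1.cexp).congr_deriv ?_
  simp only [id]
  ring

lemma norm_primaryFactor_sub_one_le {x : ℂ} {R : ℝ} (hx : ‖x‖ ≤ R) :
    ‖primaryFactor x - 1‖ ≤ Real.exp (R + R ^ 2 / 2) * ‖x‖ ^ 3 := by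
  have h1 := (convex_closedBall (0 : ℂ) ‖x‖).norm_image_sub_le_of_norm_hasDerivWithin_le
    (f := primaryFactor) (C := Real.exp (R + R ^ 2 / 2) * ‖x‖ ^ 2) (x := 0) (y := x)
    (fun y _ ↦ (hasDerivAt_primaryFactor y).hasDerivWithinAt) (fun y hy ↦ ?_) (by simp) (by simp)
  · simp only [sub_zero] at h1
    calc ‖primaryFactor x - 1‖ = ‖primaryFactor x - primaryFactor 0‖ := by simp [primaryFactor]
      _ ≤ _ := h1
      _ = _ := by ring
  · rw [mem_closedBall_zero_iff] at hy
    have h2 : ‖cexp (y + y ^ 2 / 2)‖ ≤ Real.exp (R + R ^ 2 / 2) := by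
      rw [Complex.norm_exp]
      refine Real.exp_le_exp.mpr ((Complex.re_le_norm _).trans ((norm_add_le _ _).trans ?_))
      rw [norm_div, norm_pow, Complex.norm_two]
      gcongr <;> exact hy.trans hx
    rw [norm_mul, norm_neg, norm_pow, mul_comm]
    gcongr

lemma norm_le_norm_latPt_of_near {a b : ℂ} (h : 0 < (b / a).im) :
    ∃ r > 0, ∀ w ∈ Metric.ball b r, ∀ m : ℤ × ℤ, r * ‖m‖ ≤ ‖latPt a w m‖ := by
  obtain ⟨r, hr, H⟩ := norm_le_norm_latPt h
  refine ⟨r / 2, by positivity, fun w hw m ↦ ?_⟩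
  have e : latPt a w m = latPt a b m - m.1 * (b - w) := by
    simp only [latPt]; ring
  have h1 : ‖(m.1 : ℂ) * (b - w)‖ ≤ ‖m‖ * (r / 2) := by
    rw [norm_mul]
    gcongr
    · simp [Prod.norm_def, Int.norm_eq_abs]
    · rw [← dist_eq_norm, dist_comm]
      exact (Metric.mem_ball.mp hw).le
  have h2 := norm_sub_norm_le (latPt a b m) (m.1 * (b - w))
  rw [e]
  linarith [H m]

lemma hasDerivAt_primaryFactor_latPt (a z : ℂ) {w : ℂ} {m : ℤ × ℤ}
    (hm : m = 0 ∨ latPt a w m ≠ 0) :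
    HasDerivAt (fun w ↦ primaryFactor (z / latPt a w m))
      (z ^ 3 * m.1 / latPt a w m ^ 4 *
        cexp (z / latPt a w m + (z / latPt a w m) ^ 2 / 2)) w := by
  rcases hm with rfl | hm
  · simpa [latPt_zero] using hasDerivAt_const w (primaryFactor 0)
  · have h1 : HasDerivAt (fun w ↦ latPt a w m) m.1 w := by
      simpa [latPt] using ((hasDerivAt_id w).const_mul (m.1 : ℂ)).const_add ((m.2 : ℂ) * a)
    have h2 := (h1.fun_inv hm).const_mul z
    simp only [← div_eq_mul_inv] at h2
    refine ((hasDerivAt_primaryFactor _).comp w h2).congr_deriv ?_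
    field_simp

lemma wSigma_eq {a b : ℂ} (h : 0 < (b / a).im) (z : ℂ) :
    wSigma a b z = z * ∏' m : ℤ × ℤ, primaryFactor (z / latPt a b m) := by
  rw [wSigma, ← tprod_latticeNZ h (fun w ↦ primaryFactor (z / w)) (by simp [primaryFactor])]
  congr 1
  refine tprod_congr fun w ↦ ?_
  rw [primaryFactor, div_pow, div_div, mul_comm ((w : ℂ) ^ 2)]

lemma tendstoLocallyUniformlyOn_prod_primaryFactor {a b : ℂ} (h : 0 < (b / a).im) (z : ℂ) :
    ∃ r > 0, TendstoLocallyUniformlyOn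
      (fun s w ↦ ∏ m ∈ s, primaryFactor (z / latPt a w m))
      (fun w ↦ ∏' m, primaryFactor (z / latPt a w m)) atTop (Metric.ball b r) ∧
      ∀ m, DifferentiableOn ℂ (fun w ↦ primaryFactor (z / latPt a w m)) (Metric.ball b r) := by
  obtain ⟨r, hr, H⟩ := norm_le_norm_latPt_of_near h
  have hd (m) : DifferentiableOn ℂ (fun w ↦ primaryFactor (z / latPt a w m))
      (Metric.ball b r) := fun w hw ↦ by
    refine (hasDerivAt_primaryFactor_latPt a z ?_).differentiableAt.differentiableWithinAt
    by_contra! hm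
    have h1 := H w hw m
    rw [hm.2, norm_zero] at h1
    have : 0 < r * ‖m‖ := mul_pos hr (norm_pos_iff.mpr hm.1)
    linarith
  refine ⟨r, hr, ?_, hd⟩
  have := Summable.hasProdLocallyUniformlyOn_one_add (K := Metric.ball b r)
    (f := fun m w ↦ primaryFactor (z / latPt a w m) - 1)
    (u := fun m : ℤ × ℤ ↦ Real.exp (‖z‖ / r + (‖z‖ / r) ^ 2 / 2) * (‖z‖ / r) ^ 3 *
      ‖m‖ ^ (-3 : ℝ)) Metric.isOpen_ball
    (summable_norm_rpow_int_prod.mul_left _) (.of_forall fun m w hw ↦ ?_)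
    (fun m ↦ ((hd m).sub_const 1).continuousOn)
  · rw [hasProdLocallyUniformlyOn_iff_tendstoLocallyUniformlyOn] at this
    simpa using this
  · rcases eq_or_ne m 0 with rfl | hm
    · simp [latPt_zero, primaryFactor]
    have hm0 : 0 < ‖m‖ := norm_pos_iff.mpr hm
    have h1 : ‖z / latPt a w m‖ ≤ ‖z‖ / r / ‖m‖ := by
      rw [norm_div, div_div]
      gcongr
      exact H w hw m
    have h2 : ‖z‖ / r / ‖m‖ ≤ ‖z‖ / r := div_le_self (by positivity) (one_le_norm_of_ne_zero hm)
    refine (norm_primaryFactor_sub_one_le (h1.trans h2)).trans ?_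
    rw [mul_assoc]
    gcongr
    refine (pow_le_pow_left₀ (norm_nonneg _) h1 3).trans_eq ?_
    rw [Real.rpow_neg hm0.le, show (3 : ℝ) = (3 : ℕ) by norm_num, Real.rpow_natCast, div_pow]
    rfl

lemma hasDerivAt_prod_primaryFactor {a b z : ℂ} (h : 0 < (b / a).im) (hz : z ∈ regularSet a b)
    (s : Finset (ℤ × ℤ)) :
    HasDerivAt (fun w ↦ ∏ m ∈ s, primaryFactor (z / latPt a w m))
      ((∏ m ∈ s, primaryFactor (z / latPt a b m)) *
        ∑ m ∈ s, z ^ 3 * weightedTerm a b (fun m ↦ m.1) m z) b := by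
  classical
  induction s using Finset.induction_on with
  | empty => simpa using hasDerivAt_const b (1 : ℂ)
  | insert m s hm ih =>
    simp only [Finset.prod_insert hm, Finset.sum_insert hm]
    refine ((hasDerivAt_primaryFactor_latPt a z (w := b) (m := m) ?_).mul ih).congr_deriv ?_
    · exact or_iff_not_imp_left.mpr fun h0 ↦ (latPt_eq_zero h).not.mpr h0
    · by_cases h0 : latPt a b m = 0
      · simp [weightedTerm, h0]
        ring
      · have h1 := latPt_sub_ne_zero hz h0
        have e : z ^ 3 * m.1 / latPt a b m ^ 4 *
            cexp (z / latPt a b m + (z / latPt a b m) ^ 2 / 2) =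
            primaryFactor (z / latPt a b m) * (z ^ 3 * weightedTerm a b (fun m ↦ m.1) m z) := by
          rw [primaryFactor, weightedTerm]
          field_simp
        rw [e]
        ring

lemma hasDerivAt_wSigma {a b z : ℂ} (h : 0 < (b / a).im) (hz : z ∈ regularSet a b) :
    HasDerivAt (fun w ↦ wSigma a w z)
      (wSigma a b z * (z ^ 3 * weightedSum a b (fun m ↦ m.1) z)) b := by
  obtain ⟨r, hr, hT, hd⟩ := tendstoLocallyUniformlyOn_prod_primaryFactor h z
  have hb : b ∈ Metric.ball b r := Metric.mem_ball_self hr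
  have hF : ∀ᶠ s : Finset (ℤ × ℤ) in atTop, DifferentiableOn ℂ
      (fun w ↦ ∏ m ∈ s, primaryFactor (z / latPt a w m)) (Metric.ball b r) :=
    .of_forall fun s ↦ .fun_finsetProd fun m _ ↦ hd m
  have h1 := (hT.deriv hF Metric.isOpen_ball).tendsto_at hb
  have h2 := (hT.tendsto_at hb).mul
    ((hasSum_weightedSum h isWeight_fst hz).mul_left (z ^ 3))
  have h3 := tendsto_nhds_unique (h1.congr fun s ↦ (hasDerivAt_prod_primaryFactor h hz s).deriv) h2
  have h4 := ((hT.differentiableOn hF Metric.isOpen_ball).differentiableAt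
    (Metric.isOpen_ball.mem_nhds hb)).hasDerivAt
  rw [h3] at h4
  refine ((h4.const_mul z).congr_of_eventuallyEq ?_).congr_deriv ?_
  · have hopen : ∀ᶠ w in 𝓝 b, 0 < (w / a).im :=
      (Complex.continuous_im.comp (continuous_id.div_const a)).continuousAt.eventually
        (lt_mem_nhds h)
    filter_upwards [hopen] with w hw using wSigma_eq hw z
  · rw [wSigma_eq h, mul_assoc]

lemma sum_Ico_one_div_sub (x : ℂ) (N : ℕ) :
    ∑ k ∈ Finset.Ico (-N : ℤ) N, 1 / (x - k) =
      1 / x + ∑ j ∈ Finset.range N, cotTerm x j - 1 / (x - N) := by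
  induction N with
  | zero => simp
  | succ N ih =>
    have e : Finset.Ico (-(N + 1 : ℕ) : ℤ) (N + 1 : ℕ) =
        insert (-(N + 1 : ℕ) : ℤ) (insert (N : ℤ) (Finset.Ico (-N : ℤ) N)) := by
      ext k
      simp only [Finset.mem_Ico, Finset.mem_insert]
      lia
    rw [e, Finset.sum_insert (by simp), Finset.sum_insert (by simp), ih,
      Finset.sum_range_succ, cotTerm]
    push_cast
    ring

lemma tendsto_one_div_sub_natCast (x : ℂ) : Tendsto (fun N : ℕ ↦ 1 / (x - N)) atTop (𝓝 0) := by
  simpa using EisensteinSeries.tendsto_zero_inv_linear_sub x 1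

lemma tendsto_one_div_add_natCast (x : ℂ) : Tendsto (fun N : ℕ ↦ 1 / (x + N)) atTop (𝓝 0) := by
  refine (neg_zero (G := ℂ) ▸ (tendsto_one_div_sub_natCast (-x)).neg).congr fun N ↦ ?_
  rw [← neg_add', div_neg, neg_neg]

lemma tendsto_sum_Ico_one_div_sub {x : ℂ} (hx : x ∈ integerComplement) :
    Tendsto (fun N : ℕ ↦ ∑ k ∈ Finset.Ico (-N : ℤ) N, 1 / (x - k)) atTop
      (𝓝 (Real.pi * cot (Real.pi * x))) := by
  simp_rw [sum_Ico_one_div_sub]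
  convert! ((tendsto_logDeriv_euler_cot_sub hx).const_add (1 / x)).sub
    (tendsto_one_div_sub_natCast x) using 2
  ring

lemma tendsto_sum_Ico_one_div_sub_shift (x : ℂ) :
    Tendsto (fun N : ℕ ↦ ∑ k ∈ Finset.Ico (-N : ℤ) N, (1 / (x + 1 - k) - 1 / (x - k))) atTop
      (𝓝 0) := by
  have e (N : ℕ) : ∑ k ∈ Finset.Ico (-N : ℤ) N, (1 / (x + 1 - k) - 1 / (x - k)) =
      1 / (x + 1 + N) - 1 / (x + 1 - N) := by
    convert! Finset.sum_Ico_int_sub N (fun k ↦ 1 / (x + 1 - k)) using 2 with k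
    · push_cast
      ring
    · simp
  simp_rw [e]
  simpa using (tendsto_one_div_add_natCast (x + 1)).sub (tendsto_one_div_sub_natCast (x + 1))

lemma tendsto_cot_pi_mul {τ : ℂ} (h : 0 < τ.im) (x : ℂ) :
    Tendsto (fun N : ℕ ↦ cot (Real.pi * (x + N * τ))) atTop (𝓝 (-I)) := by
  have h1 : Tendsto (fun N : ℕ ↦ cexp (2 * Real.pi * I * (x + N * τ))) atTop (𝓝 0) := by
    have h2 : ‖cexp (2 * Real.pi * I * τ)‖ < 1 := by
      simpa using UpperHalfPlane.norm_exp_two_pi_I_lt_one ⟨τ, h⟩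
    have h3 := (tendsto_pow_atTop_nhds_zero_of_norm_lt_one h2).const_mul
      (cexp (2 * Real.pi * I * x))
    rw [mul_zero] at h3
    refine h3.congr fun N ↦ ?_
    rw [← Complex.exp_nat_mul, ← Complex.exp_add]
    congr 1
    ring
  simp_rw [Complex.cot_pi_eq_exp_ratio]
  have h4 := (h1.add_const 1).div ((h1.const_sub 1).const_mul I) (by simp)
  convert! h4 using 2
  simp

section

variable {a b z : ℂ} (h : 0 < (b / a).im) (hz : z ∉ lattice a b)
include h hz

lemma sub_mul_div_mem_integerComplement (n : ℤ) : (z - n * b) / a ∈ integerComplement := by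
  have ha : a ≠ 0 := by rintro rfl; simp at h
  rintro ⟨k, hk⟩
  refine hz ⟨k, n, ?_⟩
  rw [eq_div_iff ha] at hk
  rw [hk]
  ring

/-- **Legendre's relation**, for the increments of the zeta series. -/
lemma legendre_relation {e₁ e₂ : ℂ}
    (h₁ : HasSum (fun m ↦ zetaTerm (z + a) (latPt a b m) - zetaTerm z (latPt a b m)) e₁)
    (h₂ : HasSum (fun m ↦ zetaTerm (z + b) (latPt a b m) - zetaTerm z (latPt a b m)) e₂) :
    b * e₁ - a * e₂ = 2 * Real.pi * I := by
  have ha : a ≠ 0 := by rintro rfl; simp at h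
  have hIco := Finset.tendsto_Ico_neg (R := ℤ)
  set x : ℤ → ℂ := fun n ↦ (z - n * b) / a with hx
  have hxC (n) : x n ∈ integerComplement := sub_mul_div_mem_integerComplement h hz n
  have e (n k : ℤ) : z - latPt a b (n, k) = a * (x n - k) := by
    simp only [latPt, hx]; field_simp; ring
  have ea (n k : ℤ) : z + a - latPt a b (n, k) = a * (x n + 1 - k) := by
    simp only [latPt, hx]; field_simp; ring
  have eb (n k : ℤ) : z + b - latPt a b (n, k) = a * (x (n - 1) - k) := by
    simp only [latPt, hx]; push_cast; field_simp; ring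
  have hf₁ (n) := (h₁.summable.prod_factor n).hasSum
  have hf₂ (n) := (h₂.summable.prod_factor n).hasSum
  have hG (n : ℤ) : Tendsto (fun N : ℕ ↦ ∑ k ∈ Finset.Ico (-N : ℤ) N, 1 / latPt a b (n, k) ^ 2)
      atTop (𝓝 (a⁻¹ * ∑' k, (zetaTerm (z + a) (latPt a b (n, k)) -
        zetaTerm z (latPt a b (n, k))))) := by
    have := (((hf₁ n).comp hIco).sub
      ((tendsto_sum_Ico_one_div_sub_shift (x n)).const_mul a⁻¹)).const_mul a⁻¹
    rw [mul_zero, sub_zero] at this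
    refine this.congr fun N ↦ ?_
    simp only [Function.comp_apply, Finset.mul_sum, ← Finset.sum_sub_distrib, zetaTerm, e, ea]
    refine Finset.sum_congr rfl fun k _ ↦ ?_
    simp only [one_div, mul_inv]
    linear_combination (1 / latPt a b (n, k) ^ 2) * mul_inv_cancel₀ ha
  have hH (n : ℤ) : ∑' k, (zetaTerm (z + b) (latPt a b (n, k)) - zetaTerm z (latPt a b (n, k))) -
      b / a * ∑' k, (zetaTerm (z + a) (latPt a b (n, k)) - zetaTerm z (latPt a b (n, k))) =
      Real.pi / a * (cot (Real.pi * x (n - 1)) - cot (Real.pi * x n)) := by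
    have h3 := (((tendsto_sum_Ico_one_div_sub (hxC (n - 1))).sub
      (tendsto_sum_Ico_one_div_sub (hxC n))).const_mul a⁻¹).add ((hG n).const_mul b)
    have h4 := tendsto_nhds_unique ((hf₂ n).comp hIco) (h3.congr fun N ↦ ?_)
    · rw [h4]
      field_simp
      ring
    · simp only [Function.comp_apply, Finset.mul_sum, ← Finset.sum_sub_distrib,
        ← Finset.sum_add_distrib, zetaTerm, e, eb]
      refine Finset.sum_congr rfl fun k _ ↦ ?_
      field_simp
      ring
  have hs := (h₂.prod_fiberwise hf₂).sub ((h₁.prod_fiberwise hf₁).mul_left (b / a))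
  simp only [hH] at hs
  have h5 := hs.comp hIco
  have h6 : Tendsto (fun N : ℕ ↦ Real.pi / a * (cot (Real.pi * ((z + b) / a + N * (b / a))) +
      cot (Real.pi * ((-z - b) / a + N * (b / a))))) atTop (𝓝 (e₂ - b / a * e₁)) := by
    refine h5.congr fun N ↦ ?_
    have e1 : x (-N - 1) = (z + b) / a + N * (b / a) := by
      simp only [hx]; push_cast; ring
    have e2 : x (N - 1) = -((-z - b) / a + N * (b / a)) := by
      simp only [hx]; push_cast; ring
    have e3 : cot (Real.pi * ((-z - b) / a + N * (b / a))) = -cot (Real.pi * x (N - 1)) := by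
      rw [e2, mul_neg, Complex.cot_eq_cos_div_sin, Complex.cot_eq_cos_div_sin, Complex.cos_neg,
        Complex.sin_neg, div_neg, neg_neg]
    have := Finset.sum_Ico_int_sub N fun n ↦ cot (Real.pi * x (n - 1))
    simp only [add_sub_cancel_right] at this
    rw [Function.comp_apply, ← Finset.mul_sum, this, e1, e3, sub_eq_add_neg]
  have h7 := tendsto_nhds_unique h6
    (((tendsto_cot_pi_mul h _).add (tendsto_cot_pi_mul h _)).const_mul (Real.pi / a))
  field_simp at h7
  linear_combination -h7

end

open Polynomial in
/-- A pointwise sum of polynomials of degree `< n` is a polynomial of degree `< n`. -/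
lemma exists_polynomial_of_hasSum {ι : Type*} {n : ℕ} {p : ι → ℂ[X]} {S : Set ℂ} {g : ℂ → ℂ}
    (hp : ∀ i, (p i).degree < n) (hS : S.Infinite)
    (hg : ∀ z ∈ S, HasSum (fun i ↦ (p i).eval z) (g z)) :
    ∃ q : ℂ[X], q.degree < n ∧ ∀ z ∈ S, g z = q.eval z := by
  obtain ⟨s, hsS, rfl⟩ := hS.exists_subset_card_eq n
  refine ⟨Lagrange.interpolate s id g, Lagrange.degree_interpolate_lt _ (Set.injOn_id _),
    fun z hz ↦ ?_⟩
  have h1 : HasSum (fun i ↦ (p i).eval z)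
      (∑ x ∈ s, g x * (Lagrange.basis s id x).eval z) := by
    have h2 := hasSum_sum fun x hx ↦
      (hg x (hsS hx)).mul_right ((Lagrange.basis s id x).eval z)
    refine h2.congr_fun fun i ↦ ?_
    conv_lhs => rw [Lagrange.eq_interpolate (Set.injOn_id _) (hp i), Lagrange.interpolate_apply]
    simp [eval_finsetSum]
  rw [(hg z hz).unique h1, Lagrange.interpolate_apply, eval_finsetSum]
  simp

section

variable {a b : ℂ}

lemma weightedSum_neg (a b : ℂ) (c : ℤ × ℤ → ℂ) (z : ℂ) :
    weightedSum a b c (-z) = weightedSum a b (fun m ↦ c (-m)) z := by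
  rw [weightedSum, ← (Equiv.neg (ℤ × ℤ)).tsum_eq]
  refine tsum_congr fun m ↦ ?_
  rw [weightedTerm, weightedTerm, Equiv.neg_apply, latPt_neg]
  congr 1
  ring

lemma weightedSum_one_neg (a b z : ℂ) : weightedSum a b 1 (-z) = weightedSum a b 1 z :=
  weightedSum_neg a b 1 z

lemma weightedSum_fst_neg (a b z : ℂ) :
    weightedSum a b (fun m ↦ m.1) (-z) = -weightedSum a b (fun m ↦ m.1) z := by
  rw [weightedSum_neg, weightedSum, weightedSum, ← tsum_neg]
  refine tsum_congr fun m ↦ ?_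
  simp only [weightedTerm, Prod.fst_neg, Int.cast_neg, neg_div]

lemma deriv_weightedSum_one_neg (a b z : ℂ) :
    deriv (weightedSum a b 1) (-z) = -deriv (weightedSum a b 1) z := by
  have := deriv_comp_neg (weightedSum a b 1) z
  simp only [weightedSum_one_neg] at this
  rw [this, neg_neg]

lemma zetaFn_neg (a b z : ℂ) : zetaFn a b (-z) = -zetaFn a b z := by
  rw [zetaFn, zetaFn, weightedSum_one_neg, div_neg]
  ring

lemma add_latPt_mem_lattice_iff {z : ℂ} (j : ℤ × ℤ) :
    z + latPt a b j ∈ lattice a b ↔ z ∈ lattice a b := by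
  simp only [mem_lattice_iff]
  refine ⟨fun ⟨m, hm⟩ ↦ ⟨m + -j, ?_⟩, fun ⟨m, hm⟩ ↦ ⟨m + j, ?_⟩⟩
  · rw [latPt_add, hm, latPt_neg, add_neg_cancel_right]
  · rw [latPt_add, hm]

lemma neg_mem_lattice_iff {z : ℂ} : -z ∈ lattice a b ↔ z ∈ lattice a b := by
  simp only [mem_lattice_iff]
  refine ⟨fun ⟨m, hm⟩ ↦ ⟨-m, ?_⟩, fun ⟨m, hm⟩ ↦ ⟨-m, ?_⟩⟩
  · rw [latPt_neg, hm, neg_neg]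
  · rw [latPt_neg, hm]

lemma infinite_compl_lattice (a b : ℂ) : (lattice a b)ᶜ.Infinite := by
  intro hf
  refine not_countable_complex ?_
  rw [← Set.union_compl_self (lattice a b)]
  exact (countable_lattice a b).union hf.countable

variable (h : 0 < (b / a).im)
include h

open Polynomial in
lemma exists_zetaFn_add (j : ℤ × ℤ) :
    ∃ η, ∀ z ∉ lattice a b, zetaFn a b (z + latPt a b j) = zetaFn a b z + η := by
  set ω := latPt a b j with hω
  have hmem (z : ℂ) : z + ω ∈ lattice a b ↔ z ∈ lattice a b := add_latPt_mem_lattice_iff j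
  obtain ⟨q, hq, hqz⟩ := exists_polynomial_of_hasSum (n := 2)
    (p := fun m ↦ C (1 / latPt a b m ^ 2 - 1 / latPt a b (m + -j) ^ 2) * X +
      C (1 / latPt a b m - 1 / latPt a b (m + -j) + ω / latPt a b m ^ 2))
    (g := fun z ↦ zetaFn a b (z + ω) - zetaFn a b z)
    (fun m ↦ degree_linear_lt) (infinite_compl_lattice a b) fun z hz ↦ by
      have h1 := hasSum_zetaTerm h ((hmem z).not.mpr hz)
      have h2 := (Equiv.addRight (-j)).hasSum_iff.mpr (hasSum_zetaTerm h hz)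
      refine (h1.sub h2).congr_fun fun m ↦ ?_
      have e : z - latPt a b (m + -j) = z + ω - latPt a b m := by
        rw [latPt_add, latPt_neg]
        ring
      simp only [eval_add, eval_mul, eval_C, eval_X, Function.comp_apply, Equiv.coe_addRight,
        zetaTerm, e]
      ring
  obtain ⟨α, β, rfl⟩ := exists_eq_X_add_C_of_natDegree_le_one (p := q)
    (natDegree_le_iff_degree_le.mpr (Order.le_of_lt_succ hq))
  have hα : α = 0 := by
    obtain ⟨z, hz, hz'⟩ := (infinite_compl_lattice a b).exists_notMem_finset {-ω / 2}
    have h1 := hqz z hz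
    have h2 := hqz (-(z + ω)) (neg_mem_lattice_iff.not.mpr ((hmem z).not.mpr hz))
    rw [show -(z + ω) + ω = -z by ring, zetaFn_neg, zetaFn_neg] at h2
    simp only [eval_add, eval_mul, eval_C, eval_X] at h1 h2
    have h3 : α * (z + ω / 2) = 0 := by linear_combination (h2 - h1) / 2
    refine (mul_eq_zero.mp h3).resolve_right fun h4 ↦ hz' ?_
    simp only [Finset.mem_singleton]
    linear_combination h4
  subst hα
  refine ⟨β, fun z hz ↦ ?_⟩
  have := hqz z hz
  simp at this
  linear_combination this

lemma hasDerivAt_zetaFn {z : ℂ} (hz : z ∉ lattice a b) :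
    HasDerivAt (zetaFn a b) (-pFn a b z) z := by
  have hr := compl_lattice_subset a b hz
  have hz0 : z ≠ 0 := by
    rintro rfl
    exact hz (mem_lattice_iff.mpr ⟨0, latPt_zero a b⟩)
  have h1 := ((differentiableOn_weightedSum h isWeight_one).differentiableAt
    ((isOpen_regularSet h).mem_nhds hr)).hasDerivAt
  refine (((hasDerivAt_const z (1 : ℂ)).div (hasDerivAt_id z) hz0).sub
    ((hasDerivAt_pow 3 z).mul h1)).congr_deriv ?_
  simp [pFn]
  ring

lemma pFn_add (j : ℤ × ℤ) {z : ℂ} (hz : z ∉ lattice a b) :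
    pFn a b (z + latPt a b j) = pFn a b z := by
  obtain ⟨η, hη⟩ := exists_zetaFn_add h j
  have h1 := (hasDerivAt_zetaFn h ((add_latPt_mem_lattice_iff j).not.mpr hz)).comp_add_const z _
  have h2 := (hasDerivAt_zetaFn h hz).add_const η
  refine neg_injective (h1.unique (h2.congr_of_eventuallyEq ?_))
  filter_upwards [(isOpen_compl_lattice h).mem_nhds hz] with w hw using hη w hw

lemma half_notMem_lattice : a / 2 ∉ lattice a b := by
  intro hm
  obtain ⟨m, hm⟩ := mem_lattice_iff.mp hm
  have h1 : latPt a b (2 * m.1, 2 * m.2 - 1) = 0 := by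
    simp only [latPt] at hm ⊢
    push_cast
    linear_combination 2 * hm
  have h2 : 2 * m.2 - 1 = 0 := congrArg Prod.snd ((latPt_eq_zero h).mp h1)
  lia

lemma zetaFn_add_fst {z : ℂ} (hz : z ∉ lattice a b) :
    zetaFn a b (z + a) = zetaFn a b z + eta1 a b := by
  have ea : latPt a b (0, 1) = a := by simp [latPt]
  obtain ⟨η, hη⟩ := exists_zetaFn_add h (0, 1)
  rw [ea] at hη
  have h1 := hη (-(a / 2)) (neg_mem_lattice_iff.not.mpr (half_notMem_lattice h))
  rw [show -(a / 2) + a = a / 2 by ring, zetaFn_neg] at h1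
  rw [hη z hz, eta1, wZeta_eq h (half_notMem_lattice h)]
  linear_combination -h1

lemma exists_zetaFn_add_snd : ∃ η, b * eta1 a b - a * η = 2 * Real.pi * I ∧
    ∀ z ∉ lattice a b, zetaFn a b (z + b) = zetaFn a b z + η := by
  have ea : latPt a b (0, 1) = a := by simp [latPt]
  have eb : latPt a b (1, 0) = b := by simp [latPt]
  obtain ⟨η, hη⟩ := exists_zetaFn_add h (1, 0)
  rw [eb] at hη
  refine ⟨η, ?_, hη⟩
  have hz := half_notMem_lattice h
  have hza := (add_latPt_mem_lattice_iff (0, 1)).not.mpr hz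
  have hzb := (add_latPt_mem_lattice_iff (1, 0)).not.mpr hz
  rw [ea] at hza
  rw [eb] at hzb
  have h1 := (hasSum_zetaTerm h hza).sub (hasSum_zetaTerm h hz)
  have h2 := (hasSum_zetaTerm h hzb).sub (hasSum_zetaTerm h hz)
  rw [zetaFn_add_fst h hz, add_sub_cancel_left] at h1
  rw [hη _ hz, add_sub_cancel_left] at h2
  exact legendre_relation h hz h1 h2

end

/-- The difference of the two sides of the evolution equation for `log σ`, written so that it is
visibly holomorphic at the origin. -/
noncomputable def defect (a b z : ℂ) : ℂ :=
  z ^ 2 * (z * weightedSum a b (fun m ↦ m.1) z + 1 / (2 * Real.pi * I) *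
    (a / 2 * (5 * weightedSum a b 1 z + z * deriv (weightedSum a b 1) z -
      z ^ 4 * weightedSum a b 1 z ^ 2) - eta1 a b * z ^ 2 * weightedSum a b 1 z -
      5 / 2 * a * weightedSum a b 1 0))

lemma defect_neg (a b z : ℂ) : defect a b (-z) = defect a b z := by
  simp only [defect, weightedSum_one_neg, weightedSum_fst_neg, deriv_weightedSum_one_neg]
  ring

section

variable {a b : ℂ} (h : 0 < (b / a).im)
include h

lemma defect_eq {z : ℂ} (hz : z ∉ lattice a b) :
    defect a b z = z ^ 3 * weightedSum a b (fun m ↦ m.1) z + 1 / (2 * Real.pi * I) *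
      (1 / 2 * a * (pFn a b z - zetaFn a b z ^ 2) + eta1 a b * (z * zetaFn a b z - 1) -
        g2 a b / 24 * a * z ^ 2) := by
  have hz0 : z ≠ 0 := by
    rintro rfl
    exact hz (mem_lattice_iff.mpr ⟨0, latPt_zero a b⟩)
  have e1 : pFn a b z - zetaFn a b z ^ 2 = z ^ 2 * (5 * weightedSum a b 1 z +
      z * deriv (weightedSum a b 1) z - z ^ 4 * weightedSum a b 1 z ^ 2) := by
    rw [pFn, zetaFn]
    field_simp
    ring
  have e2 : z * zetaFn a b z - 1 = -z ^ 4 * weightedSum a b 1 z := by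
    rw [zetaFn]
    field_simp
    ring
  rw [e1, e2, g2_eq h, defect]
  ring

lemma hasSum_pow_three_mul_weightedSum_fst {z : ℂ} (hz : z ∉ lattice a b) :
    HasSum (fun m ↦ -m.1 * (zetaTerm z (latPt a b m) + z ^ 2 / latPt a b m ^ 3))
      (z ^ 3 * weightedSum a b (fun m ↦ m.1) z) := by
  have hr := compl_lattice_subset a b hz
  refine ((hasSum_weightedSum h isWeight_fst hr).mul_left (z ^ 3)).congr_fun fun m ↦ ?_
  rcases eq_or_ne m 0 with rfl | hm
  · simp [weightedTerm]
  · have hm' := (latPt_eq_zero h).not.mpr hm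
    rw [zetaTerm_eq hm' (latPt_sub_ne_zero hr hm'), weightedTerm]
    ring

open Polynomial in
lemma exists_pow_three_mul_weightedSum_fst_add (j : ℤ × ℤ) :
    ∃ q : ℂ[X], q.degree < 3 ∧ ∀ z ∉ lattice a b,
      (z + latPt a b j) ^ 3 * weightedSum a b (fun m ↦ m.1) (z + latPt a b j) -
        z ^ 3 * weightedSum a b (fun m ↦ m.1) z + j.1 * zetaFn a b z = q.eval z := by
  set ω := latPt a b j with hω
  refine exists_polynomial_of_hasSum (n := 3) (S := (lattice a b)ᶜ)
    (p := fun m ↦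
      C ((m + -j).1 / latPt a b (m + -j) ^ 3 - m.1 / latPt a b m ^ 3 : ℂ) * X ^ 2 +
      C (m.1 * (1 / latPt a b (m + -j) ^ 2 - 1 / latPt a b m ^ 2) -
        2 * m.1 * ω / latPt a b m ^ 3 : ℂ) * X +
      C (m.1 * (1 / latPt a b (m + -j) - 1 / latPt a b m - ω / latPt a b m ^ 2) -
        m.1 * ω ^ 2 / latPt a b m ^ 3 : ℂ))
    (g := fun z ↦ (z + ω) ^ 3 * weightedSum a b (fun m ↦ m.1) (z + ω) -
        z ^ 3 * weightedSum a b (fun m ↦ m.1) z + j.1 * zetaFn a b z)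
    (fun m ↦ degree_quadratic_lt) (infinite_compl_lattice a b) fun z hz ↦ ?_
  have h1 := hasSum_pow_three_mul_weightedSum_fst h ((add_latPt_mem_lattice_iff j).not.mpr hz)
  have h2 := (Equiv.addRight (-j)).hasSum_iff.mpr (hasSum_pow_three_mul_weightedSum_fst h hz)
  have h3 := (Equiv.addRight (-j)).hasSum_iff.mpr (hasSum_zetaTerm h hz)
  refine ((h1.sub h2).add (h3.mul_left (j.1 : ℂ))).congr_fun fun m ↦ ?_
  have e : z - latPt a b (m + -j) = z + ω - latPt a b m := by
    rw [latPt_add, latPt_neg]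
    ring
  simp only [eval_add, eval_mul, eval_pow, eval_C, eval_X, Function.comp_apply, Equiv.coe_addRight,
    zetaTerm, e, ← hω, Prod.fst_add, Prod.fst_neg, Int.cast_add, Int.cast_neg]
  ring

open Polynomial in
lemma exists_defect_add {j : ℤ × ℤ} {η : ℂ}
    (hη : ∀ z ∉ lattice a b, zetaFn a b (z + latPt a b j) = zetaFn a b z + η)
    (hj : latPt a b j * eta1 a b - a * η = 2 * Real.pi * I * j.1) :
    ∃ q : ℂ[X], q.degree < 3 ∧ ∀ z ∉ lattice a b,
      defect a b (z + latPt a b j) = defect a b z + q.eval z := by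
  obtain ⟨q, hq, hqz⟩ := exists_pow_three_mul_weightedSum_fst_add h j
  set ω := latPt a b j with hω
  set κ := g2 a b / 24 * a with hκ
  have hpi : (2 * Real.pi * I : ℂ) ≠ 0 := Complex.two_pi_I_ne_zero
  refine ⟨q + (C 0 * X ^ 2 + C (1 / (2 * Real.pi * I) * (eta1 a b * η - 2 * κ * ω)) * X +
    C (1 / (2 * Real.pi * I) * (eta1 a b * ω * η - a * η ^ 2 / 2 - κ * ω ^ 2))),
    (degree_add_le _ _).trans_lt (max_lt hq degree_quadratic_lt), fun z hz ↦ ?_⟩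
  have hz' : z + ω ∉ lattice a b := (add_latPt_mem_lattice_iff j).not.mpr hz
  rw [defect_eq h hz, defect_eq h hz', hη z hz, pFn_add h j hz]
  simp only [eval_add, eval_mul, eval_pow, eval_C, eval_X, ← hqz z hz]
  have hj' : (j.1 : ℂ) = 1 / (2 * Real.pi * I) * (ω * eta1 a b - a * η) := by
    rw [hj]
    field_simp
  rw [hj']
  ring

end

section

variable {a b : ℂ} (h : 0 < (b / a).im)
include h

lemma eq_zero_of_add_periods {f : ℂ → ℂ} (hf : DifferentiableOn ℂ f (regularSet a b))
    (h0 : f 0 = 0) (ha : ∀ z ∉ lattice a b, f (z + a) = f z)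
    (hb : ∀ z ∉ lattice a b, f (z + b) = f z) {z : ℂ} (hz : z ∈ regularSet a b) : f z = 0 := by
  set F : ℂ → ℂ := (lattice a b)ᶜ.indicator f with hF
  have hper (j : ℤ × ℤ) (hj : ∀ z ∉ lattice a b, f (z + latPt a b j) = f z) :
      Function.Periodic F (latPt a b j) := by
    intro z
    by_cases hz : z ∈ lattice a b
    · simp [hF, hz, add_latPt_mem_lattice_iff]
    · simp [hF, hz, add_latPt_mem_lattice_iff, hj z hz]
  have hFa : Function.Periodic F a := by
    simpa [latPt] using hper (0, 1) (by simpa [latPt] using ha)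
  have hFb : Function.Periodic F b := by
    simpa [latPt] using hper (1, 0) (by simpa [latPt] using hb)
  have hFm (m : ℤ × ℤ) : Function.Periodic F (latPt a b m) :=
    (hFa.int_mul m.2).add_period (hFb.int_mul m.1)
  have hFf : Set.EqOn F f (regularSet a b) := by
    intro z hz
    by_cases hz' : z ∈ lattice a b
    · have : z = 0 := by_contra fun h ↦ hz ⟨hz', h⟩
      simp [hF, this, h0]
    · simp [hF, hz']
  have hd0 {z : ℂ} (hz : z ∈ regularSet a b) : DifferentiableAt ℂ F z :=
    ((hf.congr hFf) z hz).differentiableAt ((isOpen_regularSet h).mem_nhds hz)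
  have hd : Differentiable ℂ F := by
    intro z
    by_cases hz : z ∈ lattice a b
    · obtain ⟨m, rfl⟩ := mem_lattice_iff.mp hz
      have e : F = fun w ↦ F (w + -latPt a b m) := by
        ext w
        rw [← latPt_neg, hFm]
      rw [e, differentiableAt_comp_add_const, add_neg_cancel]
      exact hd0 (zero_mem_regularSet a b)
    · exact hd0 (compl_lattice_subset a b hz)
  have hbd : Bornology.IsBounded (Set.range F) := by
    refine (IsZLattice.isCompact_range_of_periodic (periodPair h).lattice F hd.continuous
      fun z w hw ↦ ?_).isBounded
    obtain ⟨m, rfl⟩ := mem_lattice_iff.mp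
      ((coe_lattice_periodPair h).subset hw)
    exact hFm m z
  rw [← hFf hz, hd.apply_eq_apply_of_bounded hbd z 0, hFf (zero_mem_regularSet a b), h0]

omit h in
open Polynomial in
lemma iteratedDeriv_three_eval {q : ℂ[X]} (hq : q.degree < 3) (z : ℂ) :
    iteratedDeriv 3 (fun w ↦ q.eval w) z = 0 := by
  have H (n : ℕ) : iteratedDeriv n (fun w ↦ q.eval w) = fun w ↦ (derivative^[n] q).eval w := by
    induction n with
    | zero => simp
    | succ n ih =>
      ext w
      rw [iteratedDeriv_succ, ih, Polynomial.deriv, Function.iterate_succ_apply']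
  simp [H, iterate_derivative_eq_zero_of_degree_lt hq]

lemma differentiableOn_iteratedDeriv {f : ℂ → ℂ} (hf : DifferentiableOn ℂ f (regularSet a b))
    (n : ℕ) : DifferentiableOn ℂ (iteratedDeriv n f) (regularSet a b) := by
  induction n with
  | zero => simpa
  | succ n ih =>
    rw [iteratedDeriv_succ]
    exact ih.deriv (isOpen_regularSet h)

lemma differentiableOn_defect : DifferentiableOn ℂ (defect a b) (regularSet a b) := by
  have h1 := differentiableOn_weightedSum h isWeight_one
  have h2 := differentiableOn_weightedSum h isWeight_fst
  have h3 := h1.deriv (isOpen_regularSet h)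
  unfold defect
  fun_prop

lemma iteratedDeriv_three_defect_add {j : ℤ × ℤ} {η : ℂ}
    (hη : ∀ z ∉ lattice a b, zetaFn a b (z + latPt a b j) = zetaFn a b z + η)
    (hj : latPt a b j * eta1 a b - a * η = 2 * Real.pi * I * j.1) {z : ℂ} (hz : z ∉ lattice a b) :
    iteratedDeriv 3 (defect a b) (z + latPt a b j) = iteratedDeriv 3 (defect a b) z := by
  obtain ⟨q, hq, e⟩ := exists_defect_add h hη hj
  have hE : (fun w ↦ defect a b (w + latPt a b j)) =ᶠ[𝓝 z] defect a b + fun w ↦ q.eval w := by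
    filter_upwards [(isOpen_compl_lattice h).mem_nhds hz] with w hw using e w hw
  have hd : ContDiffAt ℂ (3 : ℕ) (defect a b) z :=
    ((differentiableOn_defect h).contDiffOn (isOpen_regularSet h)).contDiffAt
      ((isOpen_regularSet h).mem_nhds (compl_lattice_subset a b hz))
  have hE' := hE.iteratedDeriv_eq 3
  rwa [iteratedDeriv_comp_add_const, iteratedDeriv_add hd q.differentiable.contDiff.contDiffAt,
    iteratedDeriv_three_eval hq, add_zero] at hE'

omit h in
lemma iteratedDeriv_defect_zero_of_odd {n : ℕ} (hn : Odd n) :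
    iteratedDeriv n (defect a b) 0 = 0 := by
  have := iteratedDeriv_comp_neg n (defect a b) 0
  simp only [defect_neg, hn.neg_one_pow, neg_zero, neg_smul, one_smul] at this
  exact self_eq_neg.mp this

lemma iteratedDeriv_two_defect_zero : iteratedDeriv 2 (defect a b) 0 = 0 := by
  have h1 := differentiableOn_weightedSum h isWeight_one
  have h2 := differentiableOn_weightedSum h isWeight_fst
  have h3 := h1.deriv (isOpen_regularSet h)
  have hS := isOpen_regularSet h
  set G : ℂ → ℂ := fun z ↦ z * weightedSum a b (fun m ↦ m.1) z + 1 / (2 * Real.pi * I) *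
    (a / 2 * (5 * weightedSum a b 1 z + z * deriv (weightedSum a b 1) z -
      z ^ 4 * weightedSum a b 1 z ^ 2) - eta1 a b * z ^ 2 * weightedSum a b 1 z -
      5 / 2 * a * weightedSum a b 1 0) with hG
  have hGd : DifferentiableOn ℂ G (regularSet a b) := by fun_prop
  have h0 : G 0 = 0 := by
    simp only [hG]
    ring
  have hD : defect a b = fun z ↦ z ^ 2 * G z := rfl
  have e : deriv (defect a b) =ᶠ[𝓝 0] fun z ↦ 2 * z * G z + z ^ 2 * deriv G z := by
    filter_upwards [hS.mem_nhds (zero_mem_regularSet a b)] with z hz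
    rw [hD]
    have := (hasDerivAt_pow 2 z).mul (hGd.differentiableAt (hS.mem_nhds hz)).hasDerivAt
    exact this.deriv.trans (by simp)
  have hm := hS.mem_nhds (zero_mem_regularSet a b)
  rw [iteratedDeriv_succ, iteratedDeriv_one, e.deriv_eq]
  have t1 := (((hasDerivAt_id (0 : ℂ)).const_mul 2).mul (hGd.differentiableAt hm).hasDerivAt).add
    ((hasDerivAt_pow 2 (0 : ℂ)).mul ((hGd.deriv hS).differentiableAt hm).hasDerivAt)
  exact t1.deriv.trans (by simp [h0])

lemma defect_eq_zero {z : ℂ} (hz : z ∈ regularSet a b) : defect a b z = 0 := by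
  obtain ⟨η, hη, hadd⟩ := exists_zetaFn_add_snd h
  have hd := differentiableOn_iteratedDeriv h (differentiableOn_defect h)
  have step (n : ℕ) (h0 : iteratedDeriv n (defect a b) 0 = 0)
      (ih : ∀ z ∈ regularSet a b, iteratedDeriv (n + 1) (defect a b) z = 0) :
      ∀ z ∈ regularSet a b, iteratedDeriv n (defect a b) z = 0 := fun z hz ↦ by
    rw [← h0]
    refine (isOpen_regularSet h).is_const_of_deriv_eq_zero (isPreconnected_regularSet a b) (hd n)
      (fun w hw ↦ ?_) hz (zero_mem_regularSet a b)
    rw [← iteratedDeriv_succ]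
    exact ih w hw
  have h3 : ∀ z ∈ regularSet a b, iteratedDeriv 3 (defect a b) z = 0 := fun z hz ↦ by
    refine eq_zero_of_add_periods h (hd 3) (iteratedDeriv_defect_zero_of_odd (by decide))
      (fun w hw ↦ ?_) (fun w hw ↦ ?_) hz
    · simpa [latPt] using iteratedDeriv_three_defect_add h (j := (0, 1)) (η := eta1 a b)
        (fun z hz ↦ by simpa [latPt] using zetaFn_add_fst h hz) (by simp [latPt]) hw
    · simpa [latPt] using iteratedDeriv_three_defect_add h (j := (1, 0)) (η := η)
        (fun z hz ↦ by simpa [latPt] using hadd z hz) (by simpa [latPt] using hη) hw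
  have h2 := step 2 (iteratedDeriv_two_defect_zero h) h3
  have h1 := step 1 (iteratedDeriv_defect_zero_of_odd odd_one) h2
  exact step 0 (by simp [defect]) h1 z hz

end

end WeierstrassSigma

/-- the derivative of `ω₂ ↦ σ(z; ω₁, ω₂)` with respect to the second period. -/
theorem sigma_hasDerivAt_omega2 (z ω₁ : ℂ) (hω₁ : ω₁ ≠ 0) (ω₂ : ℂ) (hω₂ : ω₂ ≠ 0)
    (hτ : 0 < (ω₂ / ω₁).im) (hz : z ∉ lattice ω₁ ω₂) :
    HasDerivAt (fun w₂ : ℂ => wSigma ω₁ w₂ z)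
      (-(wSigma ω₁ ω₂ z * (1 / (2 * (Real.pi : ℂ) * Complex.I)) *
        (1 / 2 * ω₁ * (wP ω₁ ω₂ z - (wZeta ω₁ ω₂ z) ^ 2)
          + eta1 ω₁ ω₂ * (z * wZeta ω₁ ω₂ z - 1)
          - g2 ω₁ ω₂ / 24 * ω₁ * z ^ 2))) ω₂ := by
  have h1 := WeierstrassSigma.defect_eq hτ hz
  have hr := WeierstrassSigma.compl_lattice_subset ω₁ ω₂ hz
  rw [WeierstrassSigma.defect_eq_zero hτ hr] at h1
  refine (WeierstrassSigma.hasDerivAt_wSigma hτ hr).congr_deriv ?_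
  rw [WeierstrassSigma.wP_eq hτ hz, WeierstrassSigma.wZeta_eq hτ hz]
  linear_combination -wSigma ω₁ ω₂ z * h1
end

section
/- Let ω₁, ω₂ ∈ ℂ∖{0} with Im(ω₂/ω₁) > 0 and Ω = {m₁ω₁ + m₂ω₂ : m₁, m₂ ∈ ℤ}. Let p₁, …, p_N ∈ ℂ be pairwise non-congruent modulo Ω, and let r₁, …, r_N ∈ ℂ satisfy Σ_{j=1}^N r_j = 0. Suppose f is holomorphic on ℂ ∖ ⋃_{j}(p_j + Ω), satisfies f(z + ω₁) = f(z) and f(z + ω₂) = f(z) for all z in its domain, and for each j the function z ↦ f(z) − r_j/(z − p_j) extends holomorphically to a neighborhood of p_j. Then there exists a constant c ∈ ℂ such that f(z) = c + Σ_{j=1}^N r_j · ζ(z − p_j; ω₁, ω₂) for every z ∈ ℂ ∖ ⋃_{j}(p_j + Ω). -/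
open Complex Filter Topology

/-- The regularised simple fraction `1 / (z - w) + 1 / w + z / w ^ 2`; with the convention
`1 / 0 = 0` it is `1 / z` for `w = 0`. -/
noncomputable def zetaTerm (w z : ℂ) : ℂ := 1 / (z - w) + 1 / w + z / w ^ 2

lemma norm_zetaTerm_le (r : ℝ) (s : ℂ) (hs : ‖s‖ < r) (l : ℂ) (h : 2 * r ≤ ‖l‖) :
    ‖zetaTerm l s‖ ≤ 2 * r ^ 2 * ‖l‖ ^ (-3 : ℝ) := by
  have hr : 0 < r := (norm_nonneg s).trans_lt hs
  have hl : 0 < ‖l‖ := by linarith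
  have hl0 : l ≠ 0 := norm_pos_iff.mp hl
  have hsl : s - l ≠ 0 := by
    rw [sub_ne_zero]; rintro rfl; linarith
  have hd : ‖l‖ / 2 ≤ ‖s - l‖ := by
    rw [norm_sub_rev]
    exact le_trans (by linarith) (norm_sub_norm_le l s)
  have e : zetaTerm l s = s ^ 2 / ((s - l) * l ^ 2) := by
    unfold zetaTerm; field_simp; ring
  rw [e, norm_div, norm_mul, norm_pow, norm_pow]
  calc ‖s‖ ^ 2 / (‖s - l‖ * ‖l‖ ^ 2) ≤ r ^ 2 / (‖l‖ / 2 * ‖l‖ ^ 2) := by gcongr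
    _ = 2 * r ^ 2 / ‖l‖ ^ 3 := by field
    _ = _ := by rw [div_eq_mul_inv]; norm_cast

lemma differentiableAt_zetaTerm {w z : ℂ} (h : z ≠ w) : DifferentiableAt ℂ (zetaTerm w) z := by
  have : z - w ≠ 0 := sub_ne_zero.mpr h
  unfold zetaTerm
  fun_prop (disch := assumption)

namespace PeriodPair

variable (L : PeriodPair)

/-- The Weierstrass `ζ`-series with the term of `l₀` omitted. -/
noncomputable def zetaExcept (l₀ z : ℂ) : ℂ :=
  ∑' l : L.lattice, if (l : ℂ) = l₀ then 0 else zetaTerm l z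

/-- The Weierstrass `ζ`-function of a period pair. -/
noncomputable def zeta (z : ℂ) : ℂ := ∑' l : L.lattice, zetaTerm l z

lemma hasSumLocallyUniformly_zetaExcept (l₀ : ℂ) :
    HasSumLocallyUniformly
      (fun (l : L.lattice) (z : ℂ) ↦ if (l : ℂ) = l₀ then 0 else zetaTerm l z)
      (L.zetaExcept l₀) := by
  refine L.hasSumLocallyUniformly_aux (u := (2 * · ^ 2 * ‖·‖ ^ (-3 : ℝ))) _
    (fun _ _ ↦ (ZLattice.summable_norm_rpow _ _ (by simp; norm_num)).mul_left _) fun r hr ↦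
    Filter.eventually_atTop.mpr ⟨2 * r, ?_⟩
  rintro _ h s hs l rfl
  split_ifs
  · rw [norm_zero]; positivity
  · exact norm_zetaTerm_le r s hs l h

lemma analyticAt_zetaExcept {l₀ z : ℂ} (h : z ∈ L.lattice → z = l₀) :
    AnalyticAt ℂ (L.zetaExcept l₀) z := by
  have hd : DifferentiableOn ℂ (L.zetaExcept l₀) (L.lattice \ {l₀} : Set ℂ)ᶜ := by
    refine (L.hasSumLocallyUniformly_zetaExcept l₀).hasSumLocallyUniformlyOn.differentiableOn
      (.of_forall fun s ↦ .fun_sum fun i hi ↦ ?_) L.isOpen_compl_lattice_sdiff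
    split_ifs with hi
    · simp
    · intro x hx
      refine (differentiableAt_zetaTerm ?_).differentiableWithinAt
      rintro rfl
      exact hx ⟨i.2, hi⟩
  refine hd.analyticAt (L.isOpen_compl_lattice_sdiff.mem_nhds ?_)
  rintro ⟨h₁, h₂⟩
  exact h₂ (h h₁)

lemma coe_ne_ω₁_div_two (l : L.lattice) : (l : ℂ) ≠ L.ω₁ / 2 :=
  fun e ↦ L.ω₁_div_two_notMem_lattice (e ▸ l.2)

lemma hasSum_zeta (z : ℂ) : HasSum (fun l : L.lattice ↦ zetaTerm l z) (L.zeta z) := by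
  refine Summable.hasSum ?_
  have h := (L.hasSumLocallyUniformly_zetaExcept (L.ω₁ / 2)).hasSum (x := z)
  convert! h.summable using 2 with l
  rw [if_neg (L.coe_ne_ω₁_div_two l)]

lemma analyticAt_zeta {z : ℂ} (h : z ∉ L.lattice) : AnalyticAt ℂ L.zeta z := by
  have e : L.zeta = L.zetaExcept (L.ω₁ / 2) := by
    ext z
    refine tsum_congr fun l ↦ ?_
    rw [if_neg (L.coe_ne_ω₁_div_two l)]
  exact e ▸ L.analyticAt_zetaExcept fun h' ↦ absurd h' h

lemma zeta_eq_zetaExcept_zero_add (z : ℂ) : L.zeta z = L.zetaExcept 0 z + 1 / z := by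
  have h₁ := (L.hasSumLocallyUniformly_zetaExcept 0).hasSum (x := z)
  have h₂ := hasSum_ite_eq (0 : L.lattice) (1 / z)
  refine (L.hasSum_zeta z).unique ?_
  convert! h₁.add h₂ using 2 with l
  by_cases hl : l = 0
  · simp [hl, zetaTerm]
  · simp [hl]

lemma wZeta_eq_zeta {ω₁ ω₂ : ℂ} (h : _root_.lattice ω₁ ω₂ = L.lattice) (z : ℂ) :
    wZeta ω₁ ω₂ z = L.zeta z := by
  rw [zeta_eq_zetaExcept_zero_add, wZeta, zetaExcept, add_comm]
  congr 1
  have h₁ := tsum_subtype {w | w ∈ _root_.lattice ω₁ ω₂ ∧ w ≠ 0} (zetaTerm · z)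
  have h₂ := tsum_subtype (L.lattice : Set ℂ) fun l ↦ if l = 0 then 0 else zetaTerm l z
  refine h₁.trans (Eq.trans (tsum_congr fun w ↦ ?_) h₂.symm)
  have hw : w ∈ _root_.lattice ω₁ ω₂ ↔ w ∈ (L.lattice : Set ℂ) := by rw [h]
  by_cases h₀ : w = 0
  · simp [Set.indicator, h₀]
  by_cases hl : w ∈ (L.lattice : Set ℂ)
  · have hl' : w ∈ {w | w ∈ _root_.lattice ω₁ ω₂ ∧ w ≠ 0} := ⟨hw.mpr hl, h₀⟩
    rw [Set.indicator_of_mem hl', Set.indicator_of_mem hl, if_neg h₀]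
  · have hl' : w ∉ {w | w ∈ _root_.lattice ω₁ ω₂ ∧ w ≠ 0} := fun h' ↦ hl (hw.mp h'.1)
    rw [Set.indicator_of_notMem hl', Set.indicator_of_notMem hl]

/-- A combination of translates of `ζ` whose residues add up to zero is periodic. -/
lemma sum_mul_zeta_add_coe {ι : Type*} [Fintype ι] (p r : ι → ℂ) (hr : ∑ j, r j = 0)
    (z : ℂ) (l : L.lattice) :
    ∑ j, r j * L.zeta (z + l - p j) = ∑ j, r j * L.zeta (z - p j) := by
  have key (z : ℂ) : HasSum
      (fun w : L.lattice ↦ ∑ j, r j / (z - p j - w) - (∑ j, r j * p j) / (w : ℂ) ^ 2)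
      (∑ j, r j * L.zeta (z - p j)) := by
    convert! hasSum_sum fun j (_ : j ∈ Finset.univ) ↦
      (L.hasSum_zeta (z - p j)).mul_left (r j) using 2 with w
    have e (j : ι) : r j * zetaTerm w (z - p j) = r j / (z - p j - w)
        - (r j * p j) / (w : ℂ) ^ 2 + r j * (1 / w + z / (w : ℂ) ^ 2) := by
      unfold zetaTerm; ring
    simp_rw [e, Finset.sum_add_distrib, Finset.sum_sub_distrib, ← Finset.sum_mul, hr,
      ← Finset.sum_div]
    ring
  have h₁ := (Equiv.addRight l).hasSum_iff.mpr (key (z + l))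
  have h₂ := (Equiv.neg L.lattice).hasSum_iff.mpr (L.hasSum_weierstrassP l)
  rw [weierstrassP_coe] at h₂
  refine (h₁.unique ?_)
  convert! (key z).sub (h₂.mul_left (∑ j, r j * p j)) using 2 with w
  · have e (j : ι) : z + (l : ℂ) - p j - (w + l) = z - p j - w := by ring
    simp only [Function.comp_apply, Equiv.coe_addRight, Submodule.coe_add, e, Equiv.neg_apply,
      NegMemClass.coe_neg, sub_neg_eq_add, even_two.neg_pow, add_comm (l : ℂ)]
    ring
  · simp

lemma exists_eq_const_of_differentiable_of_periodic {G : ℂ → ℂ} (hG : Differentiable ℂ G)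
    (hper : ∀ (l : L.lattice) (z : ℂ), G (z + l) = G z) : ∃ c, ∀ z, G z = c := by
  refine hG.exists_eq_const_of_bounded ?_ |>.imp fun c hc z ↦ congrFun hc z
  have hK : IsCompact (closure (ZSpan.fundamentalDomain L.basis)) :=
    (ZSpan.fundamentalDomain_isBounded L.basis).isCompact_closure
  refine (hK.image hG.continuous).isBounded.subset ?_
  rintro _ ⟨z, rfl⟩
  refine ⟨ZSpan.fract L.basis z, subset_closure (ZSpan.fract_mem_fundamentalDomain _ _), ?_⟩
  have hm : (ZSpan.floor L.basis z : ℂ) ∈ L.lattice := by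
    rw [L.lattice_eq_span_range_basis]
    exact (ZSpan.floor L.basis z).2
  rw [← hper ⟨_, hm⟩, ZSpan.fract_apply, sub_add_cancel]

end PeriodPair

/-- A function that agrees with an analytic function on a punctured neighbourhood of every point
extends, from the set where it is continuous, to an entire function. -/
lemma exists_differentiable_eq_of_continuousAt {F : ℂ → ℂ}
    (hF : ∀ x, ∃ g : ℂ → ℂ, AnalyticAt ℂ g x ∧ F =ᶠ[𝓝[≠] x] g) :
    ∃ G : ℂ → ℂ, Differentiable ℂ G ∧ ∀ x, ContinuousAt F x → G x = F x := by
  have lim {x : ℂ} {g : ℂ → ℂ} (hg : ContinuousAt g x) (h : F =ᶠ[𝓝[≠] x] g) :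
      limUnder (𝓝[≠] x) F = g x :=
    ((hg.tendsto.mono_left nhdsWithin_le_nhds).congr' h.symm).limUnder_eq
  refine ⟨fun x ↦ limUnder (𝓝[≠] x) F, fun x ↦ ?_, fun x hx ↦ lim hx .rfl⟩
  obtain ⟨g, hg, h⟩ := hF x
  refine hg.differentiableAt.congr_of_eventuallyEq ?_
  filter_upwards [hg.eventually_analyticAt,
    eventually_eventually_nhdsWithin.mpr h |> eventually_nhdsWithin_iff.mp] with y hy₁ hy₂
  refine lim hy₁.continuousAt ?_
  by_cases hyx : y = x
  · exact hyx ▸ h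
  · have := hy₂ hyx
    rw [nhdsWithin_eq_nhds.mpr (isOpen_compl_singleton.mem_nhds hyx)] at this
    exact this.filter_mono nhdsWithin_le_nhds

/-- an elliptic function is determined by its simple poles up to a constant:
it equals `c + Σⱼ rⱼ ζ(z − pⱼ)`. -/
theorem elliptic_eq_const_add_sum_zeta (ω₁ ω₂ : ℂ) (hω₁ : ω₁ ≠ 0) (hω₂ : ω₂ ≠ 0)
    (hτ : 0 < (ω₂ / ω₁).im) (N : ℕ) (p : Fin N → ℂ)
    (hp : ∀ i j, i ≠ j → p i - p j ∉ lattice ω₁ ω₂)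
    (r : Fin N → ℂ) (hr : ∑ j, r j = 0) (f : ℂ → ℂ)
    (hf : ∀ z : ℂ, (∀ j, z - p j ∉ lattice ω₁ ω₂) → DifferentiableAt ℂ f z)
    (hper1 : ∀ z : ℂ, (∀ j, z - p j ∉ lattice ω₁ ω₂) → f (z + ω₁) = f z)
    (hper2 : ∀ z : ℂ, (∀ j, z - p j ∉ lattice ω₁ ω₂) → f (z + ω₂) = f z)
    (hres : ∀ j, ∃ g : ℂ → ℂ, AnalyticAt ℂ g (p j) ∧
      ∀ᶠ z in 𝓝[≠] (p j), f z - r j / (z - p j) = g z) :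
    ∃ c : ℂ, ∀ z : ℂ, (∀ j, z - p j ∉ lattice ω₁ ω₂) →
      f z = c + ∑ j, r j * wZeta ω₁ ω₂ (z - p j) := by
  let L : PeriodPair := ⟨ω₁, ω₂, by
    refine LinearIndependent.pair_iff.mpr fun a b h ↦ ?_
    have h' : (a : ℂ) + b * (ω₂ / ω₁) = 0 := by
      simp only [real_smul] at h
      field_simp
      simpa using h
    have hb : b = 0 := by
      have := congrArg Complex.im h'
      simpa [hτ.ne'] using this
    simpa [hb] using h'⟩
  have hL : lattice ω₁ ω₂ = L.lattice := by
    ext w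
    simp [lattice, PeriodPair.mem_lattice, L, eq_comm]
  simp only [L.wZeta_eq_zeta hL]
  simp only [hL, SetLike.mem_coe] at hp hf hper1 hper2 ⊢
  let D : Set ℂ := {z | ∀ j, z - p j ∉ L.lattice}
  have hD_open : IsOpen D := by
    simp only [D, Set.ofPred_forall]
    exact isOpen_iInter_of_finite fun j ↦
      L.isClosed_lattice.isOpen_compl.preimage (continuous_sub_right (p j))
  have hD_add (l : L.lattice) (z : ℂ) : z + l ∈ D ↔ z ∈ D := by
    refine forall_congr' fun j ↦ not_congr ?_
    rw [add_sub_right_comm]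
    exact L.lattice.add_mem_iff_left l.2
  have hD_dense : Dense D := by
    have hc : (Dᶜ).Countable := by
      have hDc : Dᶜ = ⋃ j, (fun z ↦ z + p j) '' (L.lattice : Set ℂ) := by
        ext z
        simp [D, sub_eq_add_neg]
      have : Countable L.lattice := L.latticeEquivProd.injective.countable
      rw [hDc]
      exact Set.countable_iUnion fun j ↦ (Set.countable_coe_iff.mp this).image _
    simpa using hc.dense_compl ℝ
  have hf_per (l : L.lattice) : ∀ z ∈ D, f (z + l) = f z := by
    let A : AddSubgroup ℂ :=
      { carrier := {w | w ∈ L.lattice ∧ ∀ z ∈ D, f (z + w) = f z}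
        zero_mem' := ⟨zero_mem _, by simp⟩
        add_mem' := fun {a b} ha hb ↦ ⟨add_mem ha.1 hb.1, fun z hz ↦ by
          rw [← add_assoc, hb.2 _ ((hD_add ⟨a, ha.1⟩ z).mpr hz), ha.2 z hz]⟩
        neg_mem' := fun {a} ha ↦ ⟨neg_mem ha.1, fun z hz ↦ by
          rw [← ha.2 _ ((hD_add ⟨-a, neg_mem ha.1⟩ z).mpr hz), neg_add_cancel_right]⟩ }
    have hA : L.lattice ≤ A.toIntSubmodule := by
      refine Submodule.span_le.mpr ?_
      rintro _ (rfl | rfl)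
      · exact ⟨L.ω₁_mem_lattice, hper1⟩
      · exact ⟨L.ω₂_mem_lattice, hper2⟩
    exact (hA l.2).2
  let F : ℂ → ℂ := fun z ↦ f z - ∑ j, r j * L.zeta (z - p j)
  have hF_per (l : L.lattice) (z : ℂ) (hz : z ∈ D) : F (z + l) = F z := by
    simp only [F, hf_per l z hz, L.sum_mul_zeta_add_coe p r hr]
  have hzeta {x a : ℂ} (hx : x - a ∉ L.lattice) : AnalyticAt ℂ (fun z ↦ L.zeta (z - a)) x :=
    (L.analyticAt_zeta hx).comp_of_eq (f := (· - a)) (by fun_prop) rfl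
  have hF_D : ∀ x ∈ D, AnalyticAt ℂ F x := fun x hx ↦ by
    have h₁ : AnalyticAt ℂ f x := DifferentiableOn.analyticAt
      (fun z hz ↦ (hf z hz).differentiableWithinAt) (hD_open.mem_nhds hx)
    exact h₁.sub (Finset.analyticAt_fun_sum _ fun j _ ↦ analyticAt_const.mul (hzeta (hx j)))
  have hF_p (j : Fin N) : ∃ g : ℂ → ℂ, AnalyticAt ℂ g (p j) ∧ F =ᶠ[𝓝[≠] (p j)] g := by
    obtain ⟨g, hg, h⟩ := hres j
    refine ⟨fun z ↦ g z - (r j * L.zetaExcept 0 (z - p j)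
      + ∑ i ∈ Finset.univ.erase j, r i * L.zeta (z - p i)), ?_, ?_⟩
    · refine hg.sub (.add (analyticAt_const.mul ?_) (Finset.analyticAt_fun_sum _ fun i hi ↦
        analyticAt_const.mul (hzeta (hp j i (Finset.ne_of_mem_erase hi).symm))))
      exact (L.analyticAt_zetaExcept fun _ ↦ rfl).comp_of_eq (f := (· - p j)) (by fun_prop)
        (sub_self _)
    · filter_upwards [h] with z hz
      simp only [F, ← Finset.add_sum_erase _ _ (Finset.mem_univ j), ← hz,
        L.zeta_eq_zetaExcept_zero_add (z - p j)]
      ring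
  have hF (x : ℂ) : ∃ g : ℂ → ℂ, AnalyticAt ℂ g x ∧ F =ᶠ[𝓝[≠] x] g := by
    by_cases hx : x ∈ D
    · exact ⟨F, hF_D x hx, .rfl⟩
    obtain ⟨j, hj⟩ : ∃ j, x - p j ∈ L.lattice := by simpa [D] using hx
    obtain ⟨g, hg, h⟩ := hF_p j
    refine ⟨fun z ↦ g (z - (x - p j)), hg.comp_of_eq (f := (· - (x - p j))) (by fun_prop)
      (sub_sub_cancel _ _), ?_⟩
    have hxD : ∀ᶠ z in 𝓝[≠] x, z - (x - p j) ∈ D := by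
      have h₁ : ∀ᶠ z in 𝓝 x, ∀ i, z - p i ∉ (L.lattice \ {x - p i} : Set ℂ) :=
        eventually_all.mpr fun i ↦ (continuous_sub_right (p i)).continuousAt
          (L.compl_lattice_sdiff_singleton_mem_nhds (x - p i))
      filter_upwards [nhdsWithin_le_nhds h₁, self_mem_nhdsWithin] with z hz hzx
      refine (hD_add ⟨_, hj⟩ _).mp ?_
      rw [sub_add_cancel]
      exact fun i hi ↦ hz i ⟨hi, fun e ↦ hzx (sub_left_injective e)⟩
    have ht : Tendsto (· - (x - p j)) (𝓝[≠] x) (𝓝[≠] (p j)) := by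
      refine tendsto_nhdsWithin_iff.mpr ⟨?_, ?_⟩
      · refine ((continuous_sub_right (x - p j)).tendsto' x _ ?_).mono_left nhdsWithin_le_nhds
        exact sub_sub_cancel _ _
      · filter_upwards [self_mem_nhdsWithin] with z hz e
        exact hz (by simpa [sub_eq_iff_eq_add] using e)
    filter_upwards [hxD, ht.eventually h] with z hz hz'
    rw [← hz', ← hF_per ⟨_, hj⟩ _ hz, sub_add_cancel]
  obtain ⟨G, hG, hGF⟩ := exists_differentiable_eq_of_continuousAt hF
  have hGD : ∀ z ∈ D, G z = F z := fun z hz ↦ hGF z (hF_D z hz).continuousAt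
  obtain ⟨c, hc⟩ := L.exists_eq_const_of_differentiable_of_periodic hG fun l z ↦ by
    refine congrFun (Continuous.ext_on hD_dense (f := fun z ↦ G (z + l))
      (hG.continuous.comp (continuous_add_const _)) hG.continuous fun z hz ↦ ?_) z
    simp only [hGD z hz, hGD _ ((hD_add l z).mpr hz), hF_per l z hz]
  refine ⟨c, fun z hz ↦ ?_⟩
  rw [← hc z, hGD z hz, sub_add_cancel]
end

section
/- Let ω₁, ω₂ ∈ ℂ be linearly independent over ℝ. Suppose S : ℂ → ℂ is entire and there exist constants c₁, c₂ ∈ ℂ such that S(z + ω₁) − S(z) = c₁ and S(z + ω₂) − S(z) = c₂ for all z ∈ ℂ. Then there exist α, β ∈ ℂ with S(z) = α·z + β for all z ∈ ℂ; moreover c₁ = α·ω₁ and c₂ = α·ω₂ (so in particular c₁·ω₂ = c₂·ω₁). -/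
/-- Two complex numbers that are linearly independent over `ℝ` span `ℂ` over `ℝ`. -/
theorem exists_real_combination_of_indep {ω₁ ω₂ : ℂ}
    (hindep : ∀ a b : ℝ, (a : ℂ) * ω₁ + (b : ℂ) * ω₂ = 0 → a = 0 ∧ b = 0) (z : ℂ) :
    ∃ a b : ℝ, z = (a : ℂ) * ω₁ + (b : ℂ) * ω₂ := by
  let L : ℝ × ℝ →ₗ[ℝ] ℂ :=
    (LinearMap.toSpanSingleton ℝ ℂ ω₁).coprod (LinearMap.toSpanSingleton ℝ ℂ ω₂)
  have hL (p : ℝ × ℝ) : L p = (p.1 : ℂ) * ω₁ + (p.2 : ℂ) * ω₂ := by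
    simp [L, LinearMap.coprod_apply]
  have hinj : Function.Injective L := by
    rw [injective_iff_map_eq_zero]
    intro p hp
    obtain ⟨h1, h2⟩ := hindep p.1 p.2 (by rw [← hL, hp])
    exact Prod.ext h1 h2
  have hsurj : Function.Surjective L :=
    (LinearMap.injective_iff_surjective_of_finrank_eq_finrank
      (by simp [Complex.finrank_real_complex])).1 hinj
  obtain ⟨p, rfl⟩ := hsurj z
  exact ⟨p.1, p.2, hL p⟩

/-- A continuous function on `ℂ` with two `ℝ`-linearly independent periods is bounded. -/
theorem isBounded_range_of_doubly_periodic {E : Type*} [PseudoMetricSpace E] {ω₁ ω₂ : ℂ}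
    (hindep : ∀ a b : ℝ, (a : ℂ) * ω₁ + (b : ℂ) * ω₂ = 0 → a = 0 ∧ b = 0) {f : ℂ → E}
    (hf : Continuous f) (h₁ : Function.Periodic f ω₁) (h₂ : Function.Periodic f ω₂) :
    Bornology.IsBounded (Set.range f) := by
  have hcompact : IsCompact ((fun p : ℝ × ℝ => f ((p.1 : ℂ) * ω₁ + (p.2 : ℂ) * ω₂)) ''
      (Set.Icc 0 1 ×ˢ Set.Icc 0 1)) :=
    (isCompact_Icc.prod isCompact_Icc).image (by fun_prop)
  refine hcompact.isBounded.subset ?_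
  rintro _ ⟨z, rfl⟩
  obtain ⟨a, b, rfl⟩ := exists_real_combination_of_indep hindep z
  refine ⟨(Int.fract a, Int.fract b), ⟨⟨Int.fract_nonneg a, (Int.fract_lt_one a).le⟩,
    ⟨Int.fract_nonneg b, (Int.fract_lt_one b).le⟩⟩, ?_⟩
  have key : ((Int.fract a : ℝ) : ℂ) * ω₁ + ((Int.fract b : ℝ) : ℂ) * ω₂ =
      (a : ℂ) * ω₁ + (b : ℂ) * ω₂ - ⌊a⌋ * ω₁ - ⌊b⌋ * ω₂ := by
    simp only [Int.fract]
    push_cast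
    ring
  simp only [key]
  rw [h₂.sub_int_mul_eq, h₁.sub_int_mul_eq]

/-- The derivative of a function with constant increments over `ω` is `ω`-periodic. -/
theorem deriv_periodic_of_const_increment {S : ℂ → ℂ} {ω c : ℂ}
    (h : ∀ z : ℂ, S (z + ω) - S z = c) : Function.Periodic (deriv S) ω := by
  intro z
  have hS : (fun w => S (w + ω)) = fun w => S w + c := by
    funext w
    rw [← h w]
    ring
  rw [← deriv_comp_add_const, hS, deriv_add_const]

/-- an entire function whose increments over two ℝ-linearly independent
periods are constant is affine, `S(z) = αz + β`, with `c₁ = αω₁` and `c₂ = αω₂`. -/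
theorem entire_const_increments_affine (ω₁ ω₂ : ℂ)
    (hindep : ∀ a b : ℝ, (a : ℂ) * ω₁ + (b : ℂ) * ω₂ = 0 → a = 0 ∧ b = 0)
    (S : ℂ → ℂ) (hS : Differentiable ℂ S) (c₁ c₂ : ℂ)
    (h₁ : ∀ z : ℂ, S (z + ω₁) - S z = c₁) (h₂ : ∀ z : ℂ, S (z + ω₂) - S z = c₂) :
    ∃ α β : ℂ, (∀ z : ℂ, S z = α * z + β) ∧ c₁ = α * ω₁ ∧ c₂ = α * ω₂ := by
  have hS' : Differentiable ℂ (deriv S) := hS.deriv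
  obtain ⟨α, hα⟩ := hS'.exists_const_forall_eq_of_bounded
    (isBounded_range_of_doubly_periodic hindep hS'.continuous
      (deriv_periodic_of_const_increment h₁) (deriv_periodic_of_const_increment h₂))
  have haff (z : ℂ) : S z = α * z + S 0 := by
    have hderiv (w : ℂ) : HasDerivAt (fun w => S w - α * w) 0 w := by
      have hSw : HasDerivAt S α w := hα w ▸ (hS w).hasDerivAt
      exact (hSw.sub ((hasDerivAt_id' w).const_mul α)).congr_deriv (by ring)
    have := is_const_of_deriv_eq_zero (fun w => (hderiv w).differentiableAt)
      (fun w => (hderiv w).deriv) z 0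
    linear_combination this
  refine ⟨α, S 0, haff, ?_, ?_⟩
  · rw [← h₁ 0, zero_add, haff ω₁, add_sub_cancel_right]
  · rw [← h₂ 0, zero_add, haff ω₂, add_sub_cancel_right]
end

section
/- Let I ⊆ ℝ be an open interval, U ⊆ ℂ open, and F : U × I → ℂ continuously differentiable such that for each t both z ↦ F(z, t) and z ↦ (∂F/∂t)(z, t) are holomorphic on U. Let z₀ : I → U be differentiable with (∂F/∂z)(z₀(t), t) = 0 and (∂²F/∂z²)(z₀(t), t) ≠ 0 for all t ∈ I. Set E(t) = F(z₀(t), t). Then for each t ∈ I, the function H(z, t) = (∂F/∂t)(z, t)/(∂F/∂z)(z, t) has a simple pole at z = z₀(t) with residue E'(t)/(∂²F/∂z²)(z₀(t), t); that is, lim_{z→z₀(t)} (z − z₀(t))·H(z, t) = E'(t)/(∂²F/∂z²)(z₀(t), t). -/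
open Complex Filter Topology

/-- At a point where the `z`-derivative of `F(·, t)` vanishes, the derivative of `F` along a curve
`s ↦ (γ s, s)` is the partial derivative in `t`. -/
theorem deriv_along_curve_of_critical_point {F : ℂ × ℝ → ℂ} {γ : ℝ → ℂ} {t : ℝ}
    (hF : DifferentiableAt ℝ F (γ t, t)) (hγ : DifferentiableAt ℝ γ t)
    (hz : HasDerivAt (fun w => F (w, t)) 0 (γ t)) :
    deriv (fun s => F (γ s, s)) t = deriv (fun s => F (γ t, s)) t := by
  have hL := hF.hasFDerivAt
  have hcurve : HasDerivAt (fun s => F (γ s, s)) (fderiv ℝ F (γ t, t) (deriv γ t, 1)) t :=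
    HasFDerivAt.comp_hasDerivAt (f := fun s => (γ s, s)) t hL
      (hγ.hasDerivAt.prodMk (hasDerivAt_id t))
  have hvert : HasDerivAt (fun s => F (γ t, s)) (fderiv ℝ F (γ t, t) (0, 1)) t :=
    HasFDerivAt.comp_hasDerivAt (f := fun s => (γ t, s)) t hL
      ((hasDerivAt_const t (γ t)).prodMk (hasDerivAt_id t))
  have hhor : HasFDerivAt (fun w => F (w, t))
      ((fderiv ℝ F (γ t, t)).comp (ContinuousLinearMap.inl ℝ ℂ ℝ)) (γ t) :=
    HasFDerivAt.comp (f := fun w => (w, t)) (γ t) hL (hasFDerivAt_prodMk_left (γ t) t)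
  have hzero : fderiv ℝ F (γ t, t) (deriv γ t, 0) = 0 := by
    simpa using DFunLike.congr_fun (hhor.unique (hz.hasFDerivAt.restrictScalars ℝ)) (deriv γ t)
  rw [hcurve.deriv, hvert.deriv, show (deriv γ t, (1 : ℝ)) = (deriv γ t, 0) + (0, 1) by simp,
    map_add, hzero, zero_add]

/-- at a moving simple critical point `z₀(t)` of `F(·, t)`, the function
`H(z, t) = Ḟ/F'` has a simple pole with residue `Ė(t)/F''(z₀(t), t)`,
where `E(t) = F(z₀(t), t)`. -/
theorem H_simple_pole_at_critical_point
    (I : Set ℝ) (hIopen : IsOpen I) (hIconn : I.OrdConnected)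
    (U : Set ℂ) (hU : IsOpen U) (F : ℂ × ℝ → ℂ)
    (hF : ContDiffOn ℝ 1 F (U ×ˢ I))
    (hFholo : ∀ t ∈ I, ∀ z ∈ U, DifferentiableAt ℂ (fun w => F (w, t)) z)
    (hFtholo : ∀ t ∈ I, ∀ z ∈ U,
      DifferentiableAt ℂ (fun w => deriv (fun s => F (w, s)) t) z)
    (z₀ : ℝ → ℂ) (hz₀mem : ∀ t ∈ I, z₀ t ∈ U)
    (hz₀diff : ∀ t ∈ I, DifferentiableAt ℝ z₀ t)
    (hcrit : ∀ t ∈ I, deriv (fun w => F (w, t)) (z₀ t) = 0)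
    (hsimple : ∀ t ∈ I, deriv (deriv (fun w => F (w, t))) (z₀ t) ≠ 0) :
    ∀ t ∈ I,
      Tendsto
        (fun z : ℂ => (z - z₀ t) *
          (deriv (fun s => F (z, s)) t / deriv (fun w => F (w, t)) z))
        (𝓝[≠] (z₀ t))
        (𝓝 (deriv (fun s => F (z₀ s, s)) t / deriv (deriv (fun w => F (w, t))) (z₀ t))) := by
  intro t ht
  have hFdiff : DifferentiableAt ℝ F (z₀ t, t) :=
    (hF.contDiffAt ((hU.prod hIopen).mem_nhds ⟨hz₀mem t ht, ht⟩)).differentiableAt one_ne_zero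
  have hz := (hFholo t ht _ (hz₀mem t ht)).hasDerivAt
  rw [hcrit t ht] at hz
  rw [deriv_along_curve_of_critical_point hFdiff (hz₀diff t ht) hz]
  have hnum : Tendsto (fun z => deriv (fun s => F (z, s)) t) (𝓝[≠] (z₀ t))
      (𝓝 (deriv (fun s => F (z₀ t, s)) t)) :=
    (hFtholo t ht _ (hz₀mem t ht)).continuousAt.tendsto.mono_left nhdsWithin_le_nhds
  have hslope := hasDerivAt_iff_tendsto_slope.1
    (differentiableAt_of_deriv_ne_zero (hsimple t ht)).hasDerivAt
  refine (hnum.div hslope (hsimple t ht)).congr fun z => ?_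
  simp only [Pi.div_apply, slope_def_field, hcrit t ht, sub_zero]
  rw [div_div_eq_mul_div, mul_comm, mul_div_assoc]
end

section
/- Let F and h be holomorphic on an open neighborhood of z₀ ∈ ℂ, with F'(z₀) = 0, and let L ∈ ℂ. Define G(z) = F'(z)·(L/(z − z₀) + h(z)) for z ≠ z₀ in that neighborhood. Then G extends holomorphically to z₀ with G(z₀) = F''(z₀)·L, and the derivative of the extension at z₀ equals G'(z₀) = F''(z₀)·h(z₀) + (1/2)·F'''(z₀)·L. -/
open Complex Filter Topology

/-- The divided difference `dslope f a` of a function holomorphic on `U` has derivative `f''(a) / 2`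
at the base point `a`. -/
theorem deriv_dslope_same_of_differentiableOn {U : Set ℂ} (hU : IsOpen U) {a : ℂ} (ha : a ∈ U)
    {f : ℂ → ℂ} (hf : DifferentiableOn ℂ f U) :
    deriv (dslope f a) a = 1 / 2 * deriv (deriv f) a := by
  have hd : DifferentiableOn ℂ (dslope f a) U :=
    (differentiableOn_dslope (hU.mem_nhds ha)).2 hf
  have hfd : f = fun z => f a + (z - a) * dslope f a z := by
    funext z
    have := sub_smul_dslope f a z
    rw [smul_eq_mul] at this
    rw [this]
    ring
  have hderiv : deriv f =ᶠ[𝓝 a] fun z => dslope f a z + (z - a) * deriv (dslope f a) z := by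
    filter_upwards [hU.mem_nhds ha] with z hz
    have hdz := (hd.differentiableAt (hU.mem_nhds hz)).hasDerivAt
    have hprod := (((hasDerivAt_id z).sub_const a).mul hdz).const_add (f a)
    have hfz := hprod.congr_of_eventuallyEq (Eventually.of_forall (congrFun hfd))
    simpa using hfz.deriv
  have hda := (hd.differentiableAt (hU.mem_nhds ha)).hasDerivAt
  have hdda := ((hd.deriv hU).differentiableAt (hU.mem_nhds ha)).hasDerivAt
  have h2 := hda.add (((hasDerivAt_id a).sub_const a).mul hdda)
  rw [hderiv.deriv_eq, show deriv (fun z => dslope f a z + (z - a) * deriv (dslope f a) z) a = _ from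
    h2.deriv]
  simp
  ring

/-- if `F'(z₀) = 0` then `G(z) = F'(z)(L/(z − z₀) + h(z))` extends
holomorphically across `z₀` with `G(z₀) = F''(z₀)L` and
`G'(z₀) = F''(z₀)h(z₀) + (1/2)F'''(z₀)L`. -/
theorem critical_point_product_extension (U : Set ℂ) (hU : IsOpen U) (z₀ : ℂ)
    (hz₀ : z₀ ∈ U) (F h : ℂ → ℂ) (hF : DifferentiableOn ℂ F U)
    (hh : DifferentiableOn ℂ h U) (hF' : deriv F z₀ = 0) (L : ℂ) :
    ∃ G : ℂ → ℂ, AnalyticAt ℂ G z₀ ∧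
      (∀ z ∈ U, z ≠ z₀ → G z = deriv F z * (L / (z - z₀) + h z)) ∧
      G z₀ = deriv (deriv F) z₀ * L ∧
      deriv G z₀ = deriv (deriv F) z₀ * h z₀ + 1 / 2 * deriv (deriv (deriv F)) z₀ * L := by
  have hdF : DifferentiableOn ℂ (deriv F) U := hF.deriv hU
  have hd : DifferentiableOn ℂ (dslope (deriv F) z₀) U :=
    (differentiableOn_dslope (hU.mem_nhds hz₀)).2 hdF
  refine ⟨fun z => dslope (deriv F) z₀ z * L + deriv F z * h z, ?_, ?_, ?_, ?_⟩
  · exact ((hd.mul_const L).add (hdF.mul hh)).analyticAt (hU.mem_nhds hz₀)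
  · intro z _ hz
    have hz' : z - z₀ ≠ 0 := sub_ne_zero.2 hz
    simp only [dslope_of_ne _ hz, slope_def_field, hF']
    field_simp
    ring
  · simp [hF']
  · have h1 := (hd.differentiableAt (hU.mem_nhds hz₀)).hasDerivAt
    have h2 := (hdF.differentiableAt (hU.mem_nhds hz₀)).hasDerivAt
    have h3 := (hh.differentiableAt (hU.mem_nhds hz₀)).hasDerivAt
    have h4 := (h1.mul_const L).add (h2.mul h3)
    refine h4.deriv.trans ?_
    rw [deriv_dslope_same_of_differentiableOn hU hz₀ hdF, hF']
    ring
end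

section
/- Let s₁, s₂ ∈ ℝ with −1 < s₁ < s₂ < 1, and define ℓ = (s₁·s₂ − 1 + √((1 − s₁²)·(1 − s₂²)))/(s₁ − s₂). Then 0 < ℓ < 1 and ℓ satisfies the cross-ratio equation ((−1/ℓ − 1)/(−1/ℓ + 1)) · ((1/ℓ + 1)/(1/ℓ − 1)) = ((−1 − s₂)/(−1 − s₁)) · ((1 − s₁)/(1 − s₂)), equivalently ((1 + ℓ)/(1 − ℓ))² = ((1 + s₂)·(1 − s₁))/((1 + s₁)·(1 − s₂)). -/
/-- for `−1 < s₁ < s₂ < 1`, the number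
`ℓ = (s₁s₂ − 1 + √((1 − s₁²)(1 − s₂²)))/(s₁ − s₂)` lies in `(0, 1)` and satisfies the
cross-ratio equation matching the quadruples `(−1/ℓ, 1/ℓ, −1, 1)` and `(−1, 1, s₁, s₂)`. -/
theorem ell_cross_ratio (s₁ s₂ : ℝ) (h₁ : -1 < s₁) (h₂ : s₁ < s₂) (h₃ : s₂ < 1)
    (ℓ : ℝ)
    (hℓ : ℓ = (s₁ * s₂ - 1 + Real.sqrt ((1 - s₁ ^ 2) * (1 - s₂ ^ 2))) / (s₁ - s₂)) :
    0 < ℓ ∧ ℓ < 1 ∧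
    (-1 / ℓ - 1) / (-1 / ℓ + 1) * ((1 / ℓ + 1) / (1 / ℓ - 1))
      = (-1 - s₂) / (-1 - s₁) * ((1 - s₁) / (1 - s₂)) ∧
    ((1 + ℓ) / (1 - ℓ)) ^ 2 = (1 + s₂) * (1 - s₁) / ((1 + s₁) * (1 - s₂)) := by
  have hA : 0 < (1 + s₂) * (1 - s₁) := mul_pos (by linarith) (by linarith)
  have hB : 0 < (1 + s₁) * (1 - s₂) := mul_pos (by linarith) (by linarith)
  obtain ⟨p, hp, hpA⟩ : ∃ p : ℝ, 0 < p ∧ p ^ 2 = (1 + s₂) * (1 - s₁) :=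
    ⟨_, Real.sqrt_pos.2 hA, Real.sq_sqrt hA.le⟩
  obtain ⟨q, hq, hqB⟩ : ∃ q : ℝ, 0 < q ∧ q ^ 2 = (1 + s₁) * (1 - s₂) :=
    ⟨_, Real.sqrt_pos.2 hB, Real.sq_sqrt hB.le⟩
  have hqp : q < p := lt_of_pow_lt_pow_left₀ 2 hp.le (by rw [hpA, hqB]; linarith)
  have hsqrt : Real.sqrt ((1 - s₁ ^ 2) * (1 - s₂ ^ 2)) = p * q := by
    rw [show (1 - s₁ ^ 2) * (1 - s₂ ^ 2) = (p * q) ^ 2 by rw [mul_pow, hpA, hqB]; ring]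
    exact Real.sqrt_sq (mul_pos hp hq).le
  have hℓpq : ℓ = (p - q) / (p + q) := by
    rw [hℓ, hsqrt, div_eq_div_iff (by linarith) (by linarith)]
    linear_combination (p + q) / 2 * (hpA + hqB) - (p - q) / 2 * (hpA - hqB)
  have h0 : 0 < ℓ := hℓpq ▸ div_pos (by linarith) (by linarith)
  have h1 : ℓ < 1 := by
    rw [hℓpq, div_lt_one (by linarith)]
    linarith
  have hratio : (1 + ℓ) / (1 - ℓ) = p / q := by
    rw [div_eq_div_iff (by linarith) hq.ne', hℓpq]
    field_simp
    ring
  have hsq : ((1 + ℓ) / (1 - ℓ)) ^ 2 = (1 + s₂) * (1 - s₁) / ((1 + s₁) * (1 - s₂)) := by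
    rw [hratio, div_pow, hpA, hqB]
  refine ⟨h0, h1, ?_, hsq⟩
  have hleft : (-1 / ℓ - 1) / (-1 / ℓ + 1) = (1 + ℓ) / (1 - ℓ) := by
    rw [← mul_div_mul_right _ _ (neg_ne_zero.2 h0.ne')]
    congr 1 <;> field_simp <;> ring
  have hright : (1 / ℓ + 1) / (1 / ℓ - 1) = (1 + ℓ) / (1 - ℓ) := by
    rw [← mul_div_mul_right _ _ h0.ne']
    congr 1 <;> field_simp
  have hs : (-1 - s₂) / (-1 - s₁) = (1 + s₂) / (1 + s₁) := by
    rw [← neg_div_neg_eq]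
    congr 1 <;> ring
  rw [hleft, hright, hs, ← sq, hsq, div_mul_div_comm]
end
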